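/- Let Ω ⊂ ℝ^N (N ≥ 2) be a smooth bounded domain, assume (S1), (P1), (μ1), let q ∈ C₊(ℝ^N×ℝ^N) satisfy 2/q(x,y) + μ(x,y)/N = 2 for all (x,y), and let f satisfy (F1) and (F2). Then the energy functional J has the mountain-pass geometry: (i) there exist δ > 0 and ζ > 0 such that J(u) ≥ ζ for all u ∈ X₀ with ‖u‖_{X₀} = δ; (ii) there exists φ ∈ X₀ with ‖φ‖_{X₀} > δ and J(φ) < 0. -/

import Mathlib

open MeasureTheory Set Filter ENNReal

noncomputable section

namespace VarOrderChoquard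

variable {N : ℕ}

/-- `ℝ^N` with the Euclidean structure. -/
abbrev RN (N : ℕ) := EuclideanSpace ℝ (Fin N)

/-- `Φ⁻` : infimum of a two-variable real function over `ℝ^N × ℝ^N`. -/
def inf2 (f : RN N → RN N → ℝ) : ℝ := sInf {t | ∃ x y, f x y = t}

/-- `Φ⁺` : supremum of a two-variable real function over `ℝ^N × ℝ^N`. -/
def sup2 (f : RN N → RN N → ℝ) : ℝ := sSup {t | ∃ x y, f x y = t}

/-- `Φ⁻` over a subset `D ⊆ ℝ^N`. -/
def infOn (D : Set (RN N)) (g : RN N → ℝ) : ℝ := sInf (g '' D)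

/-- `Φ⁺` over a subset `D ⊆ ℝ^N`. -/
def supOn (D : Set (RN N)) (g : RN N → ℝ) : ℝ := sSup (g '' D)

/-- `C₊(ℝ^N × ℝ^N)` : continuous with `1 < Φ⁻ ≤ Φ⁺ < ∞`. -/
def CPlus2 (f : RN N → RN N → ℝ) : Prop :=
  Continuous (fun z : RN N × RN N => f z.1 z.2) ∧ 1 < inf2 f ∧
    BddAbove {t | ∃ x y, f x y = t}

/-- `C₊(D)` for `D ⊆ ℝ^N`. -/
def CPlusOn (D : Set (RN N)) (g : RN N → ℝ) : Prop :=
  ContinuousOn g D ∧ 1 < infOn D g ∧ BddAbove (g '' D)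

/-- Condition (S1). -/
def S1 (s : RN N → RN N → ℝ) : Prop :=
  Continuous (fun z : RN N × RN N => s z.1 z.2) ∧ (∀ x y, s x y = s y x) ∧
    BddAbove {t | ∃ x y, s x y = t} ∧ 0 < inf2 s ∧ sup2 s < 1

/-- Condition (P1). -/
def P1 (s p : RN N → RN N → ℝ) : Prop :=
  CPlus2 p ∧ (∀ x y, p x y = p y x) ∧ sup2 s * sup2 p < N

/-- Condition (μ1). -/
def Mu1 (μ : RN N → RN N → ℝ) : Prop :=
  (∀ x y, μ x y = μ y x) ∧ BddAbove {t | ∃ x y, μ x y = t} ∧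
    0 < inf2 μ ∧ sup2 μ < N

/-- The critical exponent `p_s*(x) = N p(x,x) / (N - s(x,x) p(x,x))`. -/
def pstar (s p : RN N → RN N → ℝ) (x : RN N) : ℝ :=
  N * p x x / (N - s x x * p x x)

/-- The class `𝓜` : `p(x,x) ≤ r(x)q⁻ ≤ r(x)q⁺ < p_s*(x)` for all `x`. -/
def MemM (s p q : RN N → RN N → ℝ) (r : RN N → ℝ) : Prop :=
  ∀ x, p x x ≤ r x * inf2 q ∧ r x * inf2 q ≤ r x * sup2 q ∧
    r x * sup2 q < pstar s p x

/-- Variable-exponent modular `∫_U |u/l|^{γ(x)} dx`. -/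
def lmodular (U : Set (RN N)) (γ : RN N → ℝ) (u : RN N → ℝ) (l : ℝ) : ℝ≥0∞ :=
  ∫⁻ x in U, ENNReal.ofReal (|u x| / l) ^ γ x

/-- Membership in the variable-exponent Lebesgue space `L^{γ(x)}(U)`. -/
def MemVarLp (U : Set (RN N)) (γ : RN N → ℝ) (u : RN N → ℝ) : Prop :=
  Measurable u ∧ ∃ l, 0 < l ∧ lmodular U γ u l < ⊤

/-- Luxemburg norm on `L^{γ(x)}(U)`. -/
def luxNorm (U : Set (RN N)) (γ : RN N → ℝ) (u : RN N → ℝ) : ℝ :=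
  sInf {l | 0 < l ∧ lmodular U γ u l ≤ 1}

/-- Membership in the classical Lebesgue space `L^t(U)` (constant exponent `t`). -/
def MemCLp (U : Set (RN N)) (t : ℝ) (g : RN N → ℝ) : Prop :=
  Measurable g ∧ (∫⁻ x in U, ENNReal.ofReal |g x| ^ t) < ⊤

/-- The classical `L^t(U)`-norm. -/
def cLpNorm (U : Set (RN N)) (t : ℝ) (g : RN N → ℝ) : ℝ :=
  (∫⁻ x in U, ENNReal.ofReal |g x| ^ t).toReal ^ (1 / t)

/-- Gagliardo-type modular
`∫_A (|u(x)-u(y)|/l)^{p(x,y)} / |x-y|^{N+s(x,y)p(x,y)} dx dy`. -/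
def gmodular (A : Set (RN N × RN N)) (s p : RN N → RN N → ℝ) (u : RN N → ℝ)
    (l : ℝ) : ℝ≥0∞ :=
  ∫⁻ z in A, ENNReal.ofReal (|u z.1 - u z.2| / l) ^ p z.1 z.2 /
    ENNReal.ofReal (dist z.1 z.2) ^ ((N : ℝ) + s z.1 z.2 * p z.1 z.2)

/-- Membership in `W^{s(x,y),β(x),p(x,y)}(U)`. -/
def MemW (U : Set (RN N)) (s p : RN N → RN N → ℝ) (β : RN N → ℝ)
    (u : RN N → ℝ) : Prop :=
  MemVarLp U β u ∧ ∃ l, 0 < l ∧ gmodular (U ×ˢ U) s p u l < ⊤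

/-- The Gagliardo seminorm `[u]_U^{s,p}`. -/
def wSeminorm (U : Set (RN N)) (s p : RN N → RN N → ℝ) (u : RN N → ℝ) : ℝ :=
  sInf {l | 0 < l ∧ gmodular (U ×ˢ U) s p u l < 1}

/-- The norm on `W`. -/
def wNorm (U : Set (RN N)) (s p : RN N → RN N → ℝ) (β : RN N → ℝ)
    (u : RN N → ℝ) : ℝ :=
  luxNorm U β u + wSeminorm U s p u

/-- `Q = (ℝ^N × ℝ^N) \ (Ωᶜ × Ωᶜ)`. -/
def Qset (Ω : Set (RN N)) : Set (RN N × RN N) := univ \ (Ωᶜ ×ˢ Ωᶜ)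

/-- Membership in `X₀`. -/
def MemX0 (Ω : Set (RN N)) (s p : RN N → RN N → ℝ) (β : RN N → ℝ)
    (u : RN N → ℝ) : Prop :=
  Measurable u ∧ MemVarLp Ω β u ∧ (∃ l, 0 < l ∧ gmodular (Qset Ω) s p u l < ⊤) ∧
    (∀ᵐ x, x ∉ Ω → u x = 0)

/-- The `X₀`-norm. -/
def x0Norm (s p : RN N → RN N → ℝ) (u : RN N → ℝ) : ℝ :=
  sInf {l | 0 < l ∧ gmodular univ s p u l < 1}

/-- The modular `ρ_{X₀}`. -/
def rhoX0 (s p : RN N → RN N → ℝ) (u : RN N → ℝ) : ℝ≥0∞ :=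
  gmodular univ s p u 1

/-- Carathéodory function. -/
def Caratheodory (f : RN N → ℝ → ℝ) : Prop :=
  (∀ t, Measurable fun x => f x t) ∧ ∀ x, Continuous fun t => f x t

/-- `F(x,t) = ∫₀ᵗ f(x,τ) dτ`. -/
def Fant (f : RN N → ℝ → ℝ) (x : RN N) (t : ℝ) : ℝ := ∫ τ in (0:ℝ)..t, f x τ

/-- Growth condition (F1) (with data `M` and `r`). -/
def F1 (Ω : Set (RN N)) (f : RN N → ℝ → ℝ) (M : ℝ) (r : RN N → ℝ) : Prop :=
  0 < M ∧ ∀ x ∈ Ω, ∀ t : ℝ, |f x t| ≤ M * |t| ^ (r x - 1)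

/-- Ambrosetti–Rabinowitz type condition (F2) (with data `Θ`). -/
def F2 (Ω : Set (RN N)) (f : RN N → ℝ → ℝ) (Θ : ℝ) : Prop :=
  ∀ᵐ x, x ∈ Ω → ∀ t : ℝ, t ≠ 0 →
    0 < Θ * Fant f x t ∧ Θ * Fant f x t ≤ 2 * (t * f x t)

/-- The left-hand side pairing
`∫∫ |u(x)-u(y)|^{p-2}(u(x)-u(y))(w(x)-w(y)) / |x-y|^{N+sp} dx dy`. -/
def energyLHS (s p : RN N → RN N → ℝ) (u w : RN N → ℝ) : ℝ :=
  ∫ z : RN N × RN N,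
    |u z.1 - u z.2| ^ (p z.1 z.2 - 2) * (u z.1 - u z.2) * (w z.1 - w z.2) /
      dist z.1 z.2 ^ ((N : ℝ) + s z.1 z.2 * p z.1 z.2)

/-- The Choquard right-hand side `∫_Ω ∫_Ω F(x,u(x)) f(y,u(y)) w(y) / |x-y|^μ`. -/
def choquardRHS (Ω : Set (RN N)) (μ : RN N → RN N → ℝ) (f : RN N → ℝ → ℝ)
    (u w : RN N → ℝ) : ℝ :=
  ∫ x in Ω, ∫ y in Ω, Fant f x (u x) * f y (u y) * w y / dist x y ^ μ x y

/-- The energy functional `J`. -/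
def Jfun (Ω : Set (RN N)) (s p μ : RN N → RN N → ℝ) (f : RN N → ℝ → ℝ)
    (u : RN N → ℝ) : ℝ :=
  (∫ z : RN N × RN N,
    |u z.1 - u z.2| ^ p z.1 z.2 /
      (p z.1 z.2 * dist z.1 z.2 ^ ((N : ℝ) + s z.1 z.2 * p z.1 z.2)))
  - (1/2) * ∫ x in Ω, ∫ y in Ω,
      Fant f x (u x) * Fant f y (u y) / dist x y ^ μ x y

/-- `⟨J'(u), w⟩`. -/
def Jderiv (Ω : Set (RN N)) (s p μ : RN N → RN N → ℝ) (f : RN N → ℝ → ℝ)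
    (u w : RN N → ℝ) : ℝ :=
  energyLHS s p u w - choquardRHS Ω μ f u w

/-- The perturbed functional `J_λ`. -/
def Jlam (Ω : Set (RN N)) (s p μ : RN N → RN N → ℝ) (f : RN N → ℝ → ℝ)
    (α : RN N → ℝ) (lam : ℝ) (u : RN N → ℝ) : ℝ :=
  Jfun Ω s p μ f u - lam * ∫ x in Ω, |u x| ^ α x / α x

lemma le_sup2 {f : RN N → RN N → ℝ} (h : BddAbove {t | ∃ x y, f x y = t}) (x y : RN N) :
    f x y ≤ sup2 f :=
  le_csSup h ⟨x, y, rfl⟩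

lemma inf2_le {f : RN N → RN N → ℝ} (h : 0 < inf2 f) (x y : RN N) : inf2 f ≤ f x y := by
  by_cases hb : BddBelow {t | ∃ x y, f x y = t}
  · exact csInf_le hb ⟨x, y, rfl⟩
  · rw [inf2, Real.sInf_of_not_bddBelow hb] at h
    exact absurd h (lt_irrefl 0)

lemma infOn_univ_le {g : RN N → ℝ} (h : 0 < infOn univ g) (x : RN N) : infOn univ g ≤ g x := by
  by_cases hb : BddBelow (g '' univ)
  · exact csInf_le hb ⟨x, mem_univ x, rfl⟩
  · rw [infOn, Real.sInf_of_not_bddBelow hb] at h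
    exact absurd h (lt_irrefl 0)

/-- A strict bound on the diagonal over a compact set persists near the diagonal. -/
lemma exists_forall_dist_le_lt {K : Set (RN N)} (hK : IsCompact K) {g : RN N → RN N → ℝ}
    (hg : Continuous fun z : RN N × RN N => g z.1 z.2) {c : ℝ} (h : ∀ x ∈ K, g x x < c) :
    ∃ ρ, 0 < ρ ∧ ∀ x ∈ K, ∀ y, dist x y ≤ ρ → g x y < c := by
  have hd : IsCompact ((fun x : RN N => (x, x)) '' K) := hK.image (by fun_prop)
  have ho : IsOpen {z : RN N × RN N | g z.1 z.2 < c} := isOpen_lt hg continuous_const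
  obtain ⟨δ, hδ, hsub⟩ := hd.exists_cthickening_subset_open ho (by
    rintro _ ⟨x, hx, rfl⟩
    exact h x hx)
  refine ⟨δ, hδ, fun x hx y hxy => ?_⟩
  refine hsub (Metric.mem_cthickening_of_dist_le (x, y) (x, x) δ _ ⟨x, hx, rfl⟩ ?_)
  simp only [Prod.dist_eq, dist_self]
  exact max_le hδ.le (by rwa [dist_comm])

/-- Three-factor Young inequality behind the Hardy–Littlewood–Sobolev-type estimate. -/
lemma mul_mul_le_young {a b k m : ℝ} (ha : 0 ≤ a) (hb : 0 ≤ b) (hk : 0 ≤ k) (hm1 : 1 < m)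
    (hm2 : m < 2) :
    a * b * k ≤ a ^ m * k ^ (m / (2 * m - 2)) + b ^ m * k ^ (m / (2 * m - 2)) + a ^ m * b ^ m := by
  set e := m / (2 * m - 2) with he
  have hm0 : 0 < m := by linarith
  have h2 : 0 < 2 * m - 2 := by linarith
  set w := 1 - 1 / m with hw
  have hw0 : 0 < w := by
    have : 1 / m < 1 := by rw [div_lt_one hm0]; exact hm1
    linarith
  have hv0 : 0 < 1 - 2 * w := by
    have : 1 / 2 < 1 / m := one_div_lt_one_div_of_lt hm0 hm2
    linarith
  have hA : 0 ≤ a ^ m := Real.rpow_nonneg ha _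
  have hB : 0 ≤ b ^ m := Real.rpow_nonneg hb _
  have hKe : 0 ≤ k ^ e := Real.rpow_nonneg hk _
  have key := Real.geom_mean_le_arith_mean3_weighted hw0.le hw0.le hv0.le
    (mul_nonneg hA hKe) (mul_nonneg hB hKe) (mul_nonneg hA hB) (by ring)
  have hrec : ∀ c : ℝ, 0 ≤ c → (c ^ m) ^ w * (c ^ m) ^ (1 - 2 * w) = c := by
    intro c hc
    rcases hc.eq_or_lt with rfl | hc
    · rw [Real.zero_rpow hm0.ne', Real.zero_rpow hw0.ne', zero_mul]
    · rw [← Real.rpow_mul hc.le, ← Real.rpow_mul hc.le, ← Real.rpow_add hc]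
      have : m * w + m * (1 - 2 * w) = 1 := by rw [hw]; field_simp; ring
      rw [this, Real.rpow_one]
  have hke : (k ^ e) ^ w * (k ^ e) ^ w = k := by
    rcases hk.eq_or_lt with rfl | hk
    · rw [Real.zero_rpow (by positivity), Real.zero_rpow hw0.ne', zero_mul]
    · rw [← Real.rpow_mul hk.le, ← Real.rpow_add hk]
      have : e * w + e * w = 1 := by
        have h3 : m - 1 ≠ 0 := by linarith
        rw [hw, he]; field_simp; ring
      rw [this, Real.rpow_one]
  have hprod : (a ^ m * k ^ e) ^ w * (b ^ m * k ^ e) ^ w * (a ^ m * b ^ m) ^ (1 - 2 * w) =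
      a * b * k := by
    rw [Real.mul_rpow hA hKe, Real.mul_rpow hB hKe, Real.mul_rpow hA hB]
    calc _ = ((a ^ m) ^ w * (a ^ m) ^ (1 - 2 * w)) * ((b ^ m) ^ w * (b ^ m) ^ (1 - 2 * w)) *
          ((k ^ e) ^ w * (k ^ e) ^ w) := by ring
      _ = _ := by rw [hrec a ha, hrec b hb, hke]
  rw [hprod] at key
  have hw1 : w ≤ 1 := by linarith
  have h1 := mul_le_of_le_one_left (mul_nonneg hA hKe) hw1
  have h2 := mul_le_of_le_one_left (mul_nonneg hB hKe) hw1
  have h3 := mul_le_of_le_one_left (mul_nonneg hA hB) (by linarith : 1 - 2 * w ≤ 1)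
  linarith

lemma lintegral_comp_dist (φ : ℝ → ℝ≥0∞) (x : RN N) :
    ∫⁻ y, φ (dist x y) = ∫⁻ z : RN N, φ ‖z‖ := by
  rw [← lintegral_sub_right_eq_self (fun z : RN N => φ ‖z‖) x]
  simp_rw [dist_comm x, dist_eq_norm]

lemma lintegral_norm_rpow_ball_lt_top (hN : 2 ≤ N) {ν : ℝ} (hν : ν < N) (R : ℝ) :
    ∫⁻ z in Metric.ball (0 : RN N) R, ENNReal.ofReal (‖z‖ ^ (-ν)) < ⊤ := by
  have hint : IntegrableOn (fun z : RN N => ‖z‖ ^ (-ν)) (Metric.ball 0 R) volume := by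
    refine integrableOn_ball_of_norm_le_rpow (C := 1) (α := ν) ?_ ?_ ?_ ?_
    · simp; omega
    · simpa using hν
    · refine Eventually.of_forall fun z => ?_
      rw [one_mul, Real.norm_of_nonneg (Real.rpow_nonneg (norm_nonneg _) _)]
    · exact (measurable_norm.pow_const _).aestronglyMeasurable
  exact hint.lintegral_lt_top

/-- Uniform bound for the singular kernel over bounded sets. -/
lemma exists_lintegral_dist_rpow_le (hN : 2 ≤ N) {Ω : Set (RN N)} (hΩ : Bornology.IsBounded Ω)
    {ν : ℝ} (hν : ν < N) :
    ∃ C : ℝ≥0∞, C ≠ ⊤ ∧ ∀ x ∈ Ω, ∫⁻ y in Ω, ENNReal.ofReal (dist x y ^ (-ν)) ≤ C := by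
  refine ⟨_, (lintegral_norm_rpow_ball_lt_top hN hν (Metric.diam Ω + 1)).ne, fun x hx => ?_⟩
  set R := Metric.diam Ω + 1
  calc ∫⁻ y in Ω, ENNReal.ofReal (dist x y ^ (-ν))
      ≤ ∫⁻ y in Metric.ball x R, ENNReal.ofReal (dist x y ^ (-ν)) := by
        refine lintegral_mono_set fun y hy => ?_
        rw [Metric.mem_ball]
        exact (Metric.dist_le_diam_of_mem hΩ hy hx).trans_lt (lt_add_one _)
    _ = ∫⁻ y, (Iio R).indicator (fun t => ENNReal.ofReal (t ^ (-ν))) (dist x y) := by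
        rw [← lintegral_indicator measurableSet_ball]
        refine lintegral_congr fun y => ?_
        simp only [indicator, Metric.mem_ball, mem_Iio, dist_comm y x]
    _ = ∫⁻ z : RN N, (Iio R).indicator (fun t => ENNReal.ofReal (t ^ (-ν))) ‖z‖ :=
        lintegral_comp_dist _ x
    _ = ∫⁻ z in Metric.ball (0 : RN N) R, ENNReal.ofReal (‖z‖ ^ (-ν)) := by
        rw [← lintegral_indicator measurableSet_ball]
        refine lintegral_congr fun y => ?_
        simp only [indicator, Metric.mem_ball, mem_Iio, dist_zero_right]
    _ ≤ _ := le_rfl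

/-- The Gagliardo-type integrand. -/
def gker (s p : RN N → RN N → ℝ) (u : RN N → ℝ) (x y : RN N) : ℝ≥0∞ :=
  ENNReal.ofReal |u x - u y| ^ p x y / ENNReal.ofReal (dist x y) ^ ((N : ℝ) + s x y * p x y)

lemma measurable_gker {s p : RN N → RN N → ℝ} {u : RN N → ℝ} (hs : S1 s) (hp : P1 s p)
    (hu : Measurable u) : Measurable fun z : RN N × RN N => gker s p u z.1 z.2 := by
  have h1 := hs.1.measurable
  have h2 := hp.1.1.measurable
  have h3 : Measurable fun z : RN N × RN N => ENNReal.ofReal |u z.1 - u z.2| := by fun_prop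
  have h4 : Measurable fun z : RN N × RN N => ENNReal.ofReal (dist z.1 z.2) := by fun_prop
  exact (h3.pow h2).div (h4.pow (measurable_const.add (h1.mul h2)))

lemma gmodular_one_eq {s p : RN N → RN N → ℝ} {u : RN N → ℝ} (hs : S1 s) (hp : P1 s p)
    (hu : Measurable u) : gmodular univ s p u 1 = ∫⁻ x, ∫⁻ y, gker s p u x y := by
  rw [gmodular, setLIntegral_univ, Measure.volume_eq_prod]
  simp only [div_one]
  exact lintegral_prod _ (measurable_gker hs hp hu).aemeasurable

lemma P1.one_lt_inf {s p : RN N → RN N → ℝ} (hp : P1 s p) : 1 < inf2 p := hp.1.2.1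

lemma P1.inf_le {s p : RN N → RN N → ℝ} (hp : P1 s p) (x y : RN N) : inf2 p ≤ p x y :=
  inf2_le (zero_lt_one.trans hp.one_lt_inf) x y

lemma P1.one_lt {s p : RN N → RN N → ℝ} (hp : P1 s p) (x y : RN N) : 1 < p x y :=
  hp.one_lt_inf.trans_le (hp.inf_le x y)

lemma P1.le_sup {s p : RN N → RN N → ℝ} (hp : P1 s p) (x y : RN N) : p x y ≤ sup2 p :=
  le_sup2 hp.1.2.2 x y

lemma P1.one_lt_sup {s p : RN N → RN N → ℝ} (hp : P1 s p) : 1 < sup2 p :=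
  (hp.one_lt 0 0).trans_le (hp.le_sup 0 0)

lemma S1.inf_le {s : RN N → RN N → ℝ} (hs : S1 s) (x y : RN N) : inf2 s ≤ s x y :=
  inf2_le hs.2.2.2.1 x y

lemma S1.pos {s : RN N → RN N → ℝ} (hs : S1 s) (x y : RN N) : 0 < s x y :=
  hs.2.2.2.1.trans_le (hs.inf_le x y)

lemma S1.le_sup {s : RN N → RN N → ℝ} (hs : S1 s) (x y : RN N) : s x y ≤ sup2 s :=
  le_sup2 hs.2.2.1 x y

lemma S1.sup_pos {s : RN N → RN N → ℝ} (hs : S1 s) : 0 < sup2 s :=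
  (hs.pos 0 0).trans_le (hs.le_sup 0 0)

lemma mul_le_sup_mul_sup {s p : RN N → RN N → ℝ} (hs : S1 s) (hp : P1 s p) (x y : RN N) :
    s x y * p x y ≤ sup2 s * sup2 p :=
  mul_le_mul (hs.le_sup x y) (hp.le_sup x y) (zero_le_one.trans (hp.one_lt x y).le) hs.sup_pos.le

lemma sub_mul_pos {s p : RN N → RN N → ℝ} (hs : S1 s) (hp : P1 s p) (x y : RN N) :
    0 < (N : ℝ) - s x y * p x y := by
  have h := mul_le_sup_mul_sup hs hp x y
  have h' := hp.2.2
  linarith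

lemma one_le_pstar {s p : RN N → RN N → ℝ} (hs : S1 s) (hp : P1 s p) (x : RN N) :
    1 ≤ pstar s p x := by
  have h := sub_mul_pos hs hp x x
  have h1 := hp.one_lt x x
  have h2 := hs.pos x x
  rw [pstar, le_div_iff₀ h]
  have : (0 : ℝ) ≤ N := Nat.cast_nonneg N
  nlinarith [mul_pos h2 (zero_lt_one.trans h1)]

lemma exists_pstar_le {s p : RN N → RN N → ℝ} (hs : S1 s) (hp : P1 s p) :
    ∃ T, 1 ≤ T ∧ ∀ x, pstar s p x ≤ T := by
  have key : ∀ x, pstar s p x ≤ N * sup2 p / (N - sup2 s * sup2 p) := by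
    intro x
    have h := hp.2.2
    have := mul_le_sup_mul_sup hs hp x x
    have := hp.le_sup x x
    have := hp.one_lt_sup
    rw [pstar]
    gcongr
  exact ⟨_, (one_le_pstar hs hp 0).trans (key 0), key⟩

lemma continuous_pstar {s p : RN N → RN N → ℝ} (hs : S1 s) (hp : P1 s p) :
    Continuous (pstar s p) := by
  have h1 : Continuous fun x : RN N => s x x := hs.1.comp (continuous_id.prodMk continuous_id)
  have h2 : Continuous fun x : RN N => p x x := hp.1.1.comp (continuous_id.prodMk continuous_id)
  exact (continuous_const.mul h2).div (continuous_const.sub (h1.mul h2))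
    fun x => (sub_mul_pos hs hp x x).ne'

/-- Measurable functions vanishing outside `Ω` with Gagliardo modular at most one. -/
structure ModularBall (Ω : Set (RN N)) (s p : RN N → RN N → ℝ) (v : RN N → ℝ) : Prop where
  meas : Measurable v
  zero : ∀ᵐ x, x ∉ Ω → v x = 0
  le_one : gmodular univ s p v 1 ≤ 1

set_option maxHeartbeats 1000000 in
lemma exists_lintegral_abs_le (hN : 2 ≤ N) {Ω : Set (RN N)} (hΩb : Bornology.IsBounded Ω)
    {s p : RN N → RN N → ℝ} (hs : S1 s) (hp : P1 s p) :
    ∃ K : ℝ≥0∞, K ≠ ⊤ ∧ ∀ v, ModularBall Ω s p v → ∫⁻ x in Ω, ENNReal.ofReal |v x| ≤ K := by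
  obtain ⟨R, hR1, hR⟩ : ∃ R : ℝ, 1 ≤ R ∧ ∀ x ∈ Ω, ‖x‖ ≤ R := by
    obtain ⟨R, hR⟩ := hΩb.exists_norm_le
    exact ⟨max 1 R, le_max_left _ _, fun x hx => (hR x hx).trans (le_max_right _ _)⟩
  have : Nontrivial (RN N) := by
    apply Module.nontrivial_of_finrank_pos (R := ℝ)
    simp; omega
  obtain ⟨a, ha⟩ := exists_norm_eq (RN N) (by linarith : 0 ≤ R + 1)
  set A := Metric.ball a 1 with hA
  have hApos : volume A ≠ 0 := (Metric.measure_ball_pos volume a one_pos).ne'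
  have hAtop : volume A ≠ ⊤ := measure_ball_lt_top.ne
  set D : ℝ := 2 * R + 2 with hD
  have hdist : ∀ x ∈ Ω, ∀ y ∈ A, 0 < dist x y ∧ dist x y ≤ D := by
    intro x hx y hy
    have h1 := hR x hx
    have h2 : dist y a < 1 := hy
    have h3 : ‖a‖ - ‖y‖ ≤ dist y a := by
      rw [dist_comm, dist_eq_norm]; exact norm_sub_norm_le a y
    have h4 : ‖y‖ ≤ dist y a + ‖a‖ := by
      rw [dist_eq_norm]; simpa using norm_add_le (y - a) a
    have h5 : ‖y‖ - ‖x‖ ≤ dist x y := by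
      rw [dist_comm, dist_eq_norm]; exact norm_sub_norm_le y x
    have h6 : dist x y ≤ ‖x‖ + ‖y‖ := by rw [dist_eq_norm]; exact norm_sub_le x y
    constructor <;> linarith
  set E : ℝ≥0∞ := ENNReal.ofReal D ^ (2 * N : ℝ) with hE
  have hEtop : E ≠ ⊤ := ENNReal.rpow_ne_top_of_nonneg (by positivity) ofReal_ne_top
  refine ⟨(volume A * volume Ω + E) / volume A, ?_, fun v hv => ?_⟩
  · refine ENNReal.div_ne_top (ENNReal.add_ne_top.2 ⟨ENNReal.mul_ne_top hAtop ?_, hEtop⟩) hApos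
    exact hΩb.measure_lt_top.ne
  have hpt : ∀ x ∈ Ω, volume A * ENNReal.ofReal |v x| ≤
      volume A + E * ∫⁻ y, gker s p v x y := by
    intro x hx
    have hm : Measurable fun y => gker s p v x y :=
      (measurable_gker hs hp hv.meas).comp measurable_prodMk_left
    calc volume A * ENNReal.ofReal |v x| = ∫⁻ _ in A, ENNReal.ofReal |v x| := by
          rw [setLIntegral_const, mul_comm]
      _ ≤ ∫⁻ y in A, (1 + E * gker s p v x y) := by
          refine setLIntegral_mono_ae (by fun_prop) ?_
          filter_upwards [hv.zero] with y hy hyA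
          obtain ⟨hd, hdD⟩ := hdist x hx y hyA
          have hvy : v y = 0 := hy fun hyΩ => by
            obtain ⟨hd', -⟩ := hdist y hyΩ y hyA
            simp at hd'
          set e : ℝ := N + s x y * p x y
          have he : e ≤ 2 * N := by have := sub_mul_pos hs hp x y; simp only [e]; linarith
          have he0 : 0 ≤ e := by
            have := mul_pos (hs.pos x y) (zero_lt_one.trans (hp.one_lt x y))
            positivity
          have hb : ENNReal.ofReal (dist x y) ^ e ≤ E := by
            calc _ ≤ ENNReal.ofReal D ^ e := by gcongr
              _ ≤ E := ENNReal.rpow_le_rpow_of_exponent_le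
                (by rw [ENNReal.one_le_ofReal]; linarith) he
          have hb0 : ENNReal.ofReal (dist x y) ^ e ≠ 0 := by
            have : 0 < ENNReal.ofReal (dist x y) := ofReal_pos.2 hd
            exact (ENNReal.rpow_pos this ofReal_ne_top).ne'
          have hbt : ENNReal.ofReal (dist x y) ^ e ≠ ⊤ :=
            ENNReal.rpow_ne_top_of_nonneg he0 ofReal_ne_top
          have hg : ENNReal.ofReal |v x| ^ p x y ≤ E * gker s p v x y := by
            calc ENNReal.ofReal |v x| ^ p x y
                = ENNReal.ofReal (dist x y) ^ e * gker s p v x y := by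
                  rw [gker, hvy, sub_zero, ENNReal.mul_div_cancel hb0 hbt]
              _ ≤ _ := by gcongr
          refine le_trans ?_ (add_le_add_right hg 1)
          rcases le_total (ENNReal.ofReal |v x|) 1 with h | h
          · exact h.trans le_self_add
          · refine le_trans ?_ le_add_self
            conv_lhs => rw [← ENNReal.rpow_one (ENNReal.ofReal |v x|)]
            exact ENNReal.rpow_le_rpow_of_exponent_le h (hp.one_lt x y).le
      _ = volume A + E * ∫⁻ y in A, gker s p v x y := by
          rw [lintegral_add_left measurable_const, lintegral_const_mul _ hm]
          simp
      _ ≤ _ := by gcongr; exact Measure.restrict_le_self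
  have hvm := hv.meas
  rw [ENNReal.le_div_iff_mul_le (Or.inl hApos) (Or.inl hAtop), mul_comm]
  have hGm : Measurable fun x => ∫⁻ y, gker s p v x y :=
    (measurable_gker hs hp hv.meas).lintegral_prod_right'
  calc volume A * ∫⁻ x in Ω, ENNReal.ofReal |v x|
      = ∫⁻ x in Ω, volume A * ENNReal.ofReal |v x| := by
        rw [lintegral_const_mul _ (by fun_prop)]
    _ ≤ ∫⁻ x in Ω, (volume A + E * ∫⁻ y, gker s p v x y) :=
        setLIntegral_mono (by fun_prop) hpt
    _ = volume A * volume Ω + E * ∫⁻ x in Ω, ∫⁻ y, gker s p v x y := by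
        rw [lintegral_add_left measurable_const, lintegral_const_mul _ hGm, setLIntegral_const]
    _ ≤ volume A * volume Ω + E * 1 := by
        gcongr
        refine le_trans ?_ hv.le_one
        rw [gmodular_one_eq hs hp hv.meas]
        exact lintegral_mono' Measure.restrict_le_self le_rfl
    _ = _ := by rw [mul_one]

lemma div_mul_mul_cancel_of_ne_zero {a b c A : ℝ} (hA : A ≠ 0) :
    a / (c * A) * (A * b) = a / c * b := by
  field_simp

/-- In every ball there is a point at which both the values of `v` and the increments of `v` are
controlled by the averages of the corresponding integrals. -/
lemma exists_good_point (hN : 2 ≤ N) {s p : RN N → RN N → ℝ} (hs : S1 s) (hp : P1 s p)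
    {v t : RN N → ℝ} (hv : Measurable v) (ht : Measurable t) {x : RN N} {ρ K g : ℝ}
    (hρ : 0 < ρ) (hK : 0 < K) (hg : 0 < g)
    (hvK : ∫⁻ y, ENNReal.ofReal (|v y| ^ t y) ≤ ENNReal.ofReal K)
    (hvg : ∫⁻ y, gker s p v x y ≤ ENNReal.ofReal g) :
    ∃ y, dist x y < ρ ∧ |v y| ^ t y ≤ 2 * K / (volume.real (Metric.ball (0 : RN N) 1) * ρ ^ (N : ℝ)) ∧
      |v x - v y| ^ p x y ≤
        2 * g / volume.real (Metric.ball (0 : RN N) 1) * ρ ^ (s x y * p x y) := by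
  set c := volume.real (Metric.ball (0 : RN N) 1) with hc
  have hc0 : 0 < c := by
    rw [hc, Measure.real]
    exact ENNReal.toReal_pos (Metric.measure_ball_pos volume _ one_pos).ne' measure_ball_lt_top.ne
  have hvol : volume (Metric.ball x ρ) = ENNReal.ofReal (c * ρ ^ (N : ℝ)) := by
    rw [Measure.addHaar_ball_of_pos volume x hρ, hc, mul_comm, ENNReal.ofReal_mul (by positivity),
      ofReal_measureReal measure_ball_lt_top.ne]
    simp
  have hgm : Measurable fun y => gker s p v x y :=
    (measurable_gker hs hp hv).comp measurable_prodMk_left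
  have hvm : Measurable fun y => ENNReal.ofReal (|v y| ^ t y) :=
    ((continuous_abs.measurable.comp hv).pow ht).ennreal_ofReal
  have hK0 : ENNReal.ofReal K ≠ 0 := (ofReal_pos.2 hK).ne'
  have hg0 : ENNReal.ofReal g ≠ 0 := (ofReal_pos.2 hg).ne'
  set V := volume (Metric.ball x ρ) with hV
  have hV0 : V ≠ 0 := (Metric.measure_ball_pos volume _ hρ).ne'
  have hVt : V ≠ ⊤ := measure_ball_lt_top.ne
  obtain ⟨y, hy, hyle⟩ := exists_le_setLAverage (μ := volume) (s := Metric.ball x ρ)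
    (f := fun y => ENNReal.ofReal (|v y| ^ t y) / ENNReal.ofReal K +
      gker s p v x y / ENNReal.ofReal g) hV0 hVt (by fun_prop)
  have havg : (⨍⁻ y in Metric.ball x ρ, (ENNReal.ofReal (|v y| ^ t y) / ENNReal.ofReal K +
      gker s p v x y / ENNReal.ofReal g) ∂volume) ≤ 2 / V := by
    rw [setLAverage_eq]
    gcongr
    rw [lintegral_add_left (by fun_prop)]
    simp_rw [div_eq_mul_inv]
    rw [lintegral_mul_const _ hvm, lintegral_mul_const _ hgm]
    refine (add_le_add ?_ ?_).trans one_add_one_eq_two.le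
    · rw [← div_eq_mul_inv]
      refine ENNReal.div_le_of_le_mul ?_
      rw [one_mul]
      exact (lintegral_mono' Measure.restrict_le_self le_rfl).trans hvK
    · rw [← div_eq_mul_inv]
      refine ENNReal.div_le_of_le_mul ?_
      rw [one_mul]
      exact (lintegral_mono' Measure.restrict_le_self le_rfl).trans hvg
  have hle := hyle.trans havg
  have hρN : 0 < ρ ^ (N : ℝ) := Real.rpow_pos_of_pos hρ _
  have hVdiv : ∀ z : ℝ, 0 < z → ENNReal.ofReal z * (2 / V) = ENNReal.ofReal (2 * z / (c * ρ ^ (N : ℝ))) := by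
    intro z hz
    rw [ENNReal.ofReal_div_of_pos (by positivity), hvol, ENNReal.ofReal_mul zero_le_two, mul_div_assoc',
      mul_comm]
    simp
  have hdist : dist x y < ρ := by rw [dist_comm]; exact hy
  refine ⟨y, hdist, ?_, ?_⟩
  · have h1 := (ENNReal.div_le_iff hK0 ofReal_ne_top).1 (le_self_add.trans hle)
    rw [mul_comm, hVdiv K hK] at h1
    exact (ENNReal.ofReal_le_ofReal_iff (by positivity)).1 h1
  · have h1 := (ENNReal.div_le_iff hg0 ofReal_ne_top).1 (le_add_self.trans hle)
    rw [mul_comm, hVdiv g hg] at h1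
    have hp0 : 0 < p x y := zero_lt_one.trans (hp.one_lt x y)
    rcases eq_or_ne x y with rfl | hxy
    · rw [sub_self, abs_zero, Real.zero_rpow hp0.ne']
      positivity
    have hd : 0 < dist x y := dist_pos.2 hxy
    set e : ℝ := N + s x y * p x y
    have hsp := mul_pos (hs.pos x y) hp0
    have he : 0 < e := by positivity
    rw [gker, ENNReal.ofReal_rpow_of_nonneg (abs_nonneg _) hp0.le,
      ENNReal.ofReal_rpow_of_pos hd, ← ENNReal.ofReal_div_of_pos (Real.rpow_pos_of_pos hd _),
      ENNReal.ofReal_le_ofReal_iff (by positivity), div_le_iff₀ (Real.rpow_pos_of_pos hd _)] at h1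
    refine h1.trans ?_
    calc 2 * g / (c * ρ ^ (N : ℝ)) * dist x y ^ e ≤ 2 * g / (c * ρ ^ (N : ℝ)) * ρ ^ e := by gcongr
      _ = 2 * g / c * ρ ^ (s x y * p x y) := by
        rw [Real.rpow_add hρ, div_mul_mul_cancel_of_ne_zero (Real.rpow_pos_of_pos hρ _).ne']

/-- The optimisation over radii in the self-improvement of integrability. -/
lemma add_rpow_le_of_radius {n a d c K ρ₀ g σ t t' p s θ T : ℝ} (hc : 0 < c) (hK : 0 < K)
    (ha : 0 ≤ a) (hd : 0 ≤ d) (hρ : 0 < ρ₀) (hρ1 : ρ₀ ≤ 1) (hg : 1 ≤ g) (hp : 1 ≤ p)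
    (hs : 0 < s) (hθ : 0 < θ) (hθt : θ ≤ t) (ht' : 0 < t') (ht'T : t' ≤ T)
    (hat : a ^ t ≤ 2 * K / (c * (ρ₀ * g ^ (-σ)) ^ n))
    (hdp : d ^ p ≤ 2 * g / c * (ρ₀ * g ^ (-σ)) ^ (s * p))
    (hσt : σ * n * t' ≤ t) (hσp : t' * (1 / p - σ * s) ≤ 1) :
    (a + d) ^ t' ≤
      (max 1 (2 * K / (c * ρ₀ ^ n)) ^ (1 / θ) + max 1 (2 / c)) ^ T * g := by
  have hg0 : 0 < g := by linarith
  have ht : 0 < t := hθ.trans_le hθt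
  have hp0 : 0 < p := by linarith
  set A := max 1 (2 * K / (c * ρ₀ ^ n)) with hA
  set B := max 1 (2 / c) with hB
  have hA1 : 1 ≤ A := le_max_left _ _
  have hB1 : 1 ≤ B := le_max_left _ _
  have hA0 : 0 < A := by linarith
  have hB0 : 0 < B := by linarith
  have hρn : 0 < ρ₀ ^ n := Real.rpow_pos_of_pos hρ _
  have h1 : a ≤ A ^ (1 / θ) * g ^ (1 / t') := by
    have e1 : a ^ t ≤ A * g ^ (σ * n) := by
      refine hat.trans ?_
      rw [Real.mul_rpow hρ.le (Real.rpow_nonneg hg0.le _), ← Real.rpow_mul hg0.le]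
      have : 2 * K / (c * (ρ₀ ^ n * g ^ (-σ * n))) = 2 * K / (c * ρ₀ ^ n) * g ^ (σ * n) := by
        rw [neg_mul, Real.rpow_neg hg0.le]
        field_simp
      rw [this]
      gcongr
      exact le_max_right _ _
    have e2 : a ≤ (A * g ^ (σ * n)) ^ (1 / t) := by
      have := Real.rpow_le_rpow (Real.rpow_nonneg ha _) e1 (by positivity : 0 ≤ 1 / t)
      rwa [← Real.rpow_mul ha, mul_one_div_cancel ht.ne', Real.rpow_one] at this
    rw [Real.mul_rpow hA0.le (Real.rpow_nonneg hg0.le _), ← Real.rpow_mul hg0.le] at e2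
    refine e2.trans ?_
    gcongr
    · rw [mul_one_div, div_le_div_iff₀ ht ht']
      linarith
  have h2 : d ≤ B * g ^ (1 / t') := by
    have hρs : ρ₀ ^ (s * p) ≤ 1 := Real.rpow_le_one hρ.le hρ1 (by positivity)
    have e1 : d ^ p ≤ B * g ^ (1 - σ * (s * p)) := by
      refine hdp.trans ?_
      rw [Real.mul_rpow hρ.le (Real.rpow_nonneg hg0.le _), ← Real.rpow_mul hg0.le]
      have : 2 * g / c * (ρ₀ ^ (s * p) * g ^ (-σ * (s * p))) =
          2 / c * ρ₀ ^ (s * p) * g ^ (1 - σ * (s * p)) := by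
        rw [sub_eq_add_neg, Real.rpow_add hg0, Real.rpow_one, neg_mul]
        ring
      rw [this]
      gcongr
      calc 2 / c * ρ₀ ^ (s * p) ≤ 2 / c * 1 := by gcongr
        _ ≤ B := by rw [mul_one]; exact le_max_right _ _
    have e2 : d ≤ (B * g ^ (1 - σ * (s * p))) ^ (1 / p) := by
      have := Real.rpow_le_rpow (Real.rpow_nonneg hd _) e1 (by positivity : 0 ≤ 1 / p)
      rwa [← Real.rpow_mul hd, mul_one_div_cancel hp0.ne', Real.rpow_one] at this
    rw [Real.mul_rpow hB0.le (Real.rpow_nonneg hg0.le _), ← Real.rpow_mul hg0.le] at e2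
    refine e2.trans ?_
    gcongr
    · conv_rhs => rw [← Real.rpow_one B]
      apply Real.rpow_le_rpow_of_exponent_le hB1
      rw [div_le_one hp0]; exact hp
    · rw [le_div_iff₀ ht']
      refine le_trans (le_of_eq ?_) hσp
      field_simp
  have h3 : a + d ≤ (A ^ (1 / θ) + B) * g ^ (1 / t') := by rw [add_mul]; exact add_le_add h1 h2
  have hAB : 1 ≤ A ^ (1 / θ) + B := by
    have := Real.rpow_nonneg hA0.le (1 / θ)
    linarith
  calc (a + d) ^ t' ≤ ((A ^ (1 / θ) + B) * g ^ (1 / t')) ^ t' := by gcongr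
    _ = (A ^ (1 / θ) + B) ^ t' * g := by
      rw [Real.mul_rpow (by linarith) (Real.rpow_nonneg hg0.le _), ← Real.rpow_mul hg0.le,
        one_div_mul_cancel ht'.ne', Real.rpow_one]
    _ ≤ _ := by
      gcongr

/-- Uniform bound of the `θ p_s*(x)`-modular over the unit modular ball. -/
def SubcriticalBound (Ω : Set (RN N)) (s p : RN N → RN N → ℝ) (θ : ℝ) : Prop :=
  ∃ K : ℝ≥0∞, K ≠ ⊤ ∧ ∀ v, ModularBall Ω s p v →
    ∫⁻ x in Ω, ENNReal.ofReal (|v x| ^ (θ * pstar s p x)) ≤ K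

lemma rpow_le_one_add_rpow {a t t' : ℝ} (ha : 0 ≤ a) (ht : 0 ≤ t) (htt : t ≤ t') :
    a ^ t ≤ 1 + a ^ t' := by
  rcases le_total a 1 with h | h
  · have h1 := Real.rpow_le_one ha h ht
    have h2 := Real.rpow_nonneg ha t'
    linarith
  · have h1 := Real.rpow_le_rpow_of_exponent_le h htt
    linarith

lemma setLIntegral_rpow_le_of_exponent_le {Ω : Set (RN N)} (hΩo : IsOpen Ω) {v t t' : RN N → ℝ}
    (ht : ∀ x ∈ Ω, 0 ≤ t x) (htt : ∀ x ∈ Ω, t x ≤ t' x) :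
    ∫⁻ x in Ω, ENNReal.ofReal (|v x| ^ t x) ≤
      volume Ω + ∫⁻ x in Ω, ENNReal.ofReal (|v x| ^ t' x) := by
  calc ∫⁻ x in Ω, ENNReal.ofReal (|v x| ^ t x)
      ≤ ∫⁻ x in Ω, (1 + ENNReal.ofReal (|v x| ^ t' x)) := by
        refine setLIntegral_mono' hΩo.measurableSet fun x hx => ?_
        rw [← ENNReal.ofReal_one, ← ENNReal.ofReal_add zero_le_one
          (Real.rpow_nonneg (abs_nonneg _) _)]
        exact ENNReal.ofReal_le_ofReal (rpow_le_one_add_rpow (abs_nonneg _) (ht x hx) (htt x hx))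
    _ = _ := by
        rw [lintegral_add_left measurable_const, setLIntegral_const, one_mul]

lemma SubcriticalBound.mono {Ω : Set (RN N)} (hΩo : IsOpen Ω) (hΩb : Bornology.IsBounded Ω)
    {s p : RN N → RN N → ℝ} (hs : S1 s) (hp : P1 s p) {θ θ' : ℝ} (h : SubcriticalBound Ω s p θ)
    (hθ' : 0 ≤ θ') (hle : θ' ≤ θ) : SubcriticalBound Ω s p θ' := by
  obtain ⟨K, hK, hb⟩ := h
  refine ⟨volume Ω + K, ENNReal.add_ne_top.2 ⟨hΩb.measure_lt_top.ne, hK⟩, fun v hv => ?_⟩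
  have h1 := fun x => zero_le_one.trans (one_le_pstar hs hp x)
  refine (setLIntegral_rpow_le_of_exponent_le hΩo (fun x _ => mul_nonneg hθ' (h1 x))
    fun x _ => mul_le_mul_of_nonneg_right hle (h1 x)).trans ?_
  gcongr
  exact hb v hv

lemma exists_subcriticalBound (hN : 2 ≤ N) {Ω : Set (RN N)} (hΩo : IsOpen Ω)
    (hΩb : Bornology.IsBounded Ω) {s p : RN N → RN N → ℝ} (hs : S1 s) (hp : P1 s p) :
    ∃ θ, 0 < θ ∧ θ ≤ 1 ∧ SubcriticalBound Ω s p θ := by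
  obtain ⟨T, hT1, hT⟩ := exists_pstar_le hs hp
  have hT0 : 0 < T := by linarith
  obtain ⟨K, hK, hb⟩ := exists_lintegral_abs_le hN hΩb hs hp
  refine ⟨1 / T, by positivity, by rw [div_le_one hT0]; exact hT1, volume Ω + K,
    ENNReal.add_ne_top.2 ⟨hΩb.measure_lt_top.ne, hK⟩, fun v hv => ?_⟩
  have h1 := fun x => zero_le_one.trans (one_le_pstar hs hp x)
  refine (setLIntegral_rpow_le_of_exponent_le hΩo (t' := fun _ => 1)
    (fun x _ => mul_nonneg (by positivity) (h1 x)) fun x _ => ?_).trans ?_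
  · rw [one_div_mul_eq_div, div_le_one hT0]; exact hT x
  · gcongr
    simpa only [Real.rpow_one] using hb v hv

/-- Self-improvement of integrability. -/
lemma SubcriticalBound.step (hN : 2 ≤ N) {Ω : Set (RN N)} (hΩo : IsOpen Ω)
    (hΩb : Bornology.IsBounded Ω) {s p : RN N → RN N → ℝ} (hs : S1 s) (hp : P1 s p) {θ θ' : ℝ}
    (h : SubcriticalBound Ω s p θ) (hθ : 0 < θ) (hθ1 : θ ≤ 1) (hθ' : 0 < θ')
    (hlt : θ' < 1 - sup2 s * sup2 p / N * (1 - θ)) : SubcriticalBound Ω s p θ' := by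
  obtain ⟨K, hK, hb⟩ := h
  obtain ⟨T, hT1, hT⟩ := exists_pstar_le hs hp
  have hN0 : (0 : ℝ) < N := by positivity
  set κ := sup2 s * sup2 p / N with hκ
  have hκ1 : κ < 1 := by rw [hκ, div_lt_one hN0]; exact hp.2.2
  have hκN : κ * N = sup2 s * sup2 p := by rw [hκ]; field_simp
  obtain ⟨θ₁, hθ₁0, hθ₁θ, hθ₁⟩ : ∃ θ₁, 0 < θ₁ ∧ θ₁ < θ ∧ θ' < 1 - κ * (1 - θ₁) := by
    set ε := 1 - κ * (1 - θ) - θ' with hε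
    have hε0 : 0 < ε := by linarith
    have h1 := min_le_left (θ / 2) (ε / 2)
    have h2 := min_le_right (θ / 2) (ε / 2)
    have h3 : 0 < min (θ / 2) (ε / 2) := by positivity
    refine ⟨θ - min (θ / 2) (ε / 2), by linarith, by linarith, ?_⟩
    nlinarith
  set σ := θ₁ / (N * θ') with hσ
  have hps : Continuous (pstar s p) := continuous_pstar hs hp
  have hcomp : IsCompact (closure Ω) := hΩb.isCompact_closure
  obtain ⟨ρ₁, hρ₁, hE1⟩ := exists_forall_dist_le_lt hcomp
    (g := fun x y => θ₁ * pstar s p x - θ * pstar s p y) (c := 0)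
    ((continuous_const.mul (hps.comp continuous_fst)).sub
      (continuous_const.mul (hps.comp continuous_snd))) (by
      intro x _
      have := one_le_pstar hs hp x
      nlinarith)
  obtain ⟨ρ₂, hρ₂, hE2⟩ := exists_forall_dist_le_lt hcomp
    (g := fun x y => θ' * pstar s p x * (1 / p x y - σ * s x y)) (c := 1)
    ((continuous_const.mul (hps.comp continuous_fst)).mul
      ((continuous_const.div hp.1.1 fun z => (zero_lt_one.trans (hp.one_lt z.1 z.2)).ne').sub
        (continuous_const.mul hs.1))) (by
      intro x _
      have h1 := zero_lt_one.trans (hp.one_lt x x)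
      have h2 := sub_mul_pos hs hp x x
      have h3 := mul_le_sup_mul_sup hs hp x x
      have h4 : θ' * pstar s p x * (1 / p x x - σ * s x x) =
          (θ' * N - θ₁ * (s x x * p x x)) / (N - s x x * p x x) := by
        rw [pstar, hσ]; field_simp
      rw [h4, div_lt_one h2]
      nlinarith)
  set ρ₀ := min 1 (min ρ₁ ρ₂) with hρ₀
  have hρ₀0 : 0 < ρ₀ := by positivity
  set c := volume.real (Metric.ball (0 : RN N) 1) with hc
  have hc0 : 0 < c := by
    rw [hc, Measure.real]
    exact ENNReal.toReal_pos (Metric.measure_ball_pos volume _ one_pos).ne' measure_ball_lt_top.ne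
  set K' := K.toReal + 1 with hK'
  have hK'0 : 0 < K' := by positivity
  set C := (max 1 (2 * K' / (c * ρ₀ ^ (N : ℝ))) ^ (1 / θ) + max 1 (2 / c)) ^ (θ' * T) with hC
  have hC0 : 0 ≤ C := by positivity
  refine ⟨ENNReal.ofReal C * (volume Ω + 1), ENNReal.mul_ne_top ofReal_ne_top
    (ENNReal.add_ne_top.2 ⟨hΩb.measure_lt_top.ne, one_ne_top⟩), fun v hv => ?_⟩
  have hGm : Measurable fun x => ∫⁻ y, gker s p v x y :=
    (measurable_gker hs hp hv.meas).lintegral_prod_right'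
  have hG1 : ∫⁻ x, ∫⁻ y, gker s p v x y ≤ 1 := by
    rw [← gmodular_one_eq hs hp hv.meas]; exact hv.le_one
  have hGfin : ∀ᵐ x, ∫⁻ y, gker s p v x y < ⊤ :=
    ae_lt_top hGm (hG1.trans_lt one_lt_top).ne
  have hvK : ∫⁻ y, ENNReal.ofReal (|v y| ^ (θ * pstar s p y)) ≤ ENNReal.ofReal K' := by
    rw [← lintegral_add_compl _ hΩo.measurableSet]
    have hz : ∫⁻ y in Ωᶜ, ENNReal.ofReal (|v y| ^ (θ * pstar s p y)) = 0 := by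
      rw [setLIntegral_congr_fun_ae (g := fun _ => 0) hΩo.measurableSet.compl, lintegral_zero]
      filter_upwards [hv.zero] with y hy hyΩ
      have := one_le_pstar hs hp y
      rw [hy hyΩ, abs_zero, Real.zero_rpow (by positivity), ENNReal.ofReal_zero]
    rw [hz, add_zero]
    refine (hb v hv).trans ?_
    rw [← ENNReal.ofReal_toReal hK]
    exact ENNReal.ofReal_le_ofReal (by linarith)
  have hpt : ∀ᵐ x, x ∈ Ω → ENNReal.ofReal (|v x| ^ (θ' * pstar s p x)) ≤
      ENNReal.ofReal C * (1 + ∫⁻ y, gker s p v x y) := by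
    filter_upwards [hGfin] with x hxG hxΩ
    have hxc : x ∈ closure Ω := subset_closure hxΩ
    set g := 1 + (∫⁻ y, gker s p v x y).toReal with hg
    have hg1 : 1 ≤ g := le_add_of_nonneg_right ENNReal.toReal_nonneg
    have hg0 : 0 < g := by linarith
    have hgeq : 1 + ∫⁻ y, gker s p v x y = ENNReal.ofReal g := by
      rw [hg, ENNReal.ofReal_add zero_le_one ENNReal.toReal_nonneg, ENNReal.ofReal_one,
        ENNReal.ofReal_toReal hxG.ne]
    have hσ0 : 0 ≤ σ := by positivity
    have hgσ : g ^ (-σ) ≤ 1 := Real.rpow_le_one_of_one_le_of_nonpos hg1 (by linarith)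
    obtain ⟨y, hxy, hy1, hy2⟩ := exists_good_point hN hs hp hv.meas
      (t := fun y => θ * pstar s p y) (hps.measurable.const_mul θ) (x := x)
      (ρ := ρ₀ * g ^ (-σ)) (mul_pos hρ₀0 (Real.rpow_pos_of_pos hg0 _)) hK'0 hg0 hvK
      (hgeq ▸ le_add_self)
    have hxy0 : dist x y ≤ ρ₀ := hxy.le.trans (mul_le_of_le_one_right hρ₀0.le hgσ)
    have hb1 := hE1 x hxc y (hxy0.trans ((min_le_right _ _).trans (min_le_left _ _)))
    have hb2 := hE2 x hxc y (hxy0.trans ((min_le_right _ _).trans (min_le_right _ _)))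
    have hq1 := one_le_pstar hs hp x
    have hq2 := one_le_pstar hs hp y
    have hfin := add_rpow_le_of_radius (n := N) (θ := θ) (T := θ' * T) (t' := θ' * pstar s p x)
      hc0 hK'0 (abs_nonneg (v y)) (abs_nonneg (v x - v y)) hρ₀0 (min_le_left _ _) hg1
      (hp.one_lt x y).le (hs.pos x y) hθ (le_mul_of_one_le_right hθ.le hq2) (by positivity)
      (mul_le_mul_of_nonneg_left (hT x) hθ'.le) hy1 hy2 (by
        have : σ * N * (θ' * pstar s p x) = θ₁ * pstar s p x := by rw [hσ]; field_simp
        rw [this]; linarith) hb2.le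
    rw [hgeq, ← ENNReal.ofReal_mul hC0]
    refine ENNReal.ofReal_le_ofReal (le_trans ?_ hfin)
    refine Real.rpow_le_rpow (abs_nonneg _) ?_ (by positivity)
    have := abs_add_le (v y) (v x - v y)
    simpa using this
  calc ∫⁻ x in Ω, ENNReal.ofReal (|v x| ^ (θ' * pstar s p x))
      ≤ ∫⁻ x in Ω, ENNReal.ofReal C * (1 + ∫⁻ y, gker s p v x y) :=
        setLIntegral_mono_ae' hΩo.measurableSet hpt
    _ = ENNReal.ofReal C * (volume Ω + ∫⁻ x in Ω, ∫⁻ y, gker s p v x y) := by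
        rw [lintegral_const_mul _ (hGm.const_add 1), lintegral_add_left measurable_const,
          setLIntegral_const, one_mul]
    _ ≤ _ := by
        gcongr
        exact (lintegral_mono' Measure.restrict_le_self le_rfl).trans hG1

/-- The subcritical fractional Sobolev embedding with variable exponents, in modular form. -/
theorem subcriticalBound_of_lt_one (hN : 2 ≤ N) {Ω : Set (RN N)} (hΩo : IsOpen Ω)
    (hΩb : Bornology.IsBounded Ω) {s p : RN N → RN N → ℝ} (hs : S1 s) (hp : P1 s p) {θ : ℝ}
    (hθ : 0 < θ) (hθ1 : θ < 1) : SubcriticalBound Ω s p θ := by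
  have hN0 : (0 : ℝ) < N := by positivity
  set κ := sup2 s * sup2 p / N with hκ
  have hκ1 : κ < 1 := by rw [hκ, div_lt_one hN0]; exact hp.2.2
  have hκ0 : 0 < κ := by
    have := hs.sup_pos
    have := hp.one_lt_sup
    positivity
  obtain ⟨θ₀, hθ₀, hθ₀1, h0⟩ := exists_subcriticalBound hN hΩo hΩb hs hp
  obtain ⟨θ₁, hθ₁, hθ₁1, h1⟩ : ∃ θ₁, 0 < θ₁ ∧ θ₁ < 1 ∧ SubcriticalBound Ω s p θ₁ :=
    ⟨θ₀ / 2, by linarith, by linarith,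
      h0.mono hΩo hΩb hs hp (by linarith) (by linarith)⟩
  set κ' := (1 + κ) / 2 with hκ'
  have hk1 : κ' < 1 := by rw [hκ']; linarith
  have hk2 : κ < κ' := by rw [hκ']; linarith
  have hk0 : 0 < κ' := hκ0.trans hk2
  have hiter : ∀ k : ℕ, SubcriticalBound Ω s p (1 - κ' ^ k * (1 - θ₁)) := by
    intro k
    induction k with
    | zero => simpa using h1
    | succ k ih =>
      have e0 : 0 < κ' ^ k := by positivity
      have e1 : κ' ^ k ≤ 1 := pow_le_one₀ hk0.le hk1.le
      have e2 : 0 < κ' ^ k * (1 - θ₁) := mul_pos e0 (by linarith)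
      have e3 : κ' ^ k * (1 - θ₁) ≤ 1 - θ₁ := mul_le_of_le_one_left (by linarith) e1
      refine ih.step hN hΩo hΩb hs hp (by linarith) (by linarith) ?_ ?_
      · rw [pow_succ]; nlinarith
      · rw [pow_succ, ← hκ]; nlinarith
  obtain ⟨k, hk⟩ := exists_pow_lt_of_lt_one (by linarith : 0 < 1 - θ) hk1
  refine (hiter k).mono hΩo hΩb hs hp hθ.le ?_
  have e0 : 0 < κ' ^ k := by positivity
  nlinarith

lemma one_lt_of_cPlus2 {q : RN N → RN N → ℝ} (hq : CPlus2 q) (x y : RN N) : 1 < q x y :=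
  hq.2.1.trans_le (inf2_le (zero_lt_one.trans hq.2.1) x y)

lemma mu_eq (hN : 2 ≤ N) {μ q : RN N → RN N → ℝ}
    (hqμ : ∀ x y, 2 / q x y + μ x y / (N : ℝ) = 2) (x y : RN N) :
    μ x y = N * (2 - 2 / q x y) := by
  have hN0 : (0 : ℝ) < N := by positivity
  have h : μ x y / (N : ℝ) = 2 - 2 / q x y := by linarith [hqμ x y]
  rw [← h]
  field_simp

lemma sup2_lt_two (hN : 2 ≤ N) {μ q : RN N → RN N → ℝ} (hμ : Mu1 μ) (hq : CPlus2 q)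
    (hqμ : ∀ x y, 2 / q x y + μ x y / (N : ℝ) = 2) : sup2 q < 2 := by
  have hN0 : (0 : ℝ) < N := by positivity
  have h1 : sup2 μ / N < 1 := by rw [div_lt_one hN0]; exact hμ.2.2.2
  have h2 : 0 < 2 - sup2 μ / N := by linarith
  have h3 : sup2 q ≤ 2 / (2 - sup2 μ / N) := by
    refine csSup_le ⟨_, 0, 0, rfl⟩ ?_
    rintro _ ⟨x, y, rfl⟩
    have hq0 := zero_lt_one.trans (one_lt_of_cPlus2 hq x y)
    have h4 : μ x y / N ≤ sup2 μ / N := by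
      gcongr
      exact le_sup2 hμ.2.1 x y
    have h5 : 2 - sup2 μ / N ≤ 2 / q x y := by linarith [hqμ x y]
    rw [le_div_iff₀ h2]
    rw [le_div_iff₀ hq0] at h5
    linarith
  refine h3.trans_lt ?_
  rw [div_lt_iff₀ h2]
  linarith

lemma exists_exponent (hN : 2 ≤ N) {Ω : Set (RN N)} (hΩb : Bornology.IsBounded Ω)
    {s p μ q : RN N → RN N → ℝ} {r : RN N → ℝ} (hs : S1 s) (hp : P1 s p) (hμ : Mu1 μ)
    (hq : CPlus2 q) (hqμ : ∀ x y, 2 / q x y + μ x y / (N : ℝ) = 2) (hr : CPlusOn univ r)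
    (hrM : MemM s p q r) :
    ∃ m θ : ℝ, sup2 q < m ∧ m < 2 ∧ 0 < θ ∧ θ < 1 ∧ ∀ x ∈ Ω, r x * m ≤ θ * pstar s p x := by
  have hq2 := sup2_lt_two hN hμ hq hqμ
  have hq1 : 1 < sup2 q := (one_lt_of_cPlus2 hq 0 0).trans_le (le_sup2 hq.2.2 0 0)
  set c := sup2 q
  have hq0 : 0 < c := by linarith
  have hps := continuous_pstar hs hp
  have hp1 := one_le_pstar hs hp
  have hr1 : ∀ x, 1 < r x := fun x => hr.2.1.trans_le (infOn_univ_le (zero_lt_one.trans hr.2.1) x)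
  obtain ⟨β, hβ0, hβ1, hβ⟩ : ∃ β : ℝ, 0 < β ∧ β < 1 ∧ ∀ x ∈ Ω, r x * c ≤ β * pstar s p x := by
    rcases (closure Ω).eq_empty_or_nonempty with h | hne
    · refine ⟨1 / 2, by norm_num, by norm_num, fun x hx => ?_⟩
      exact absurd (h ▸ subset_closure hx : x ∈ (∅ : Set (RN N))) (notMem_empty x)
    · have hrc : Continuous r := continuousOn_univ.1 hr.1
      obtain ⟨x₀, -, hmax⟩ := hΩb.isCompact_closure.exists_isMaxOn hne
        (f := fun x => r x * c / pstar s p x)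
        ((hrc.mul continuous_const).div hps
          fun x => (zero_lt_one.trans_le (hp1 x)).ne').continuousOn
      have h0 := zero_lt_one.trans_le (hp1 x₀)
      have h1 := zero_lt_one.trans (hr1 x₀)
      refine ⟨r x₀ * c / pstar s p x₀, by positivity, ?_, fun x hx => ?_⟩
      · rw [div_lt_one h0]; exact (hrM x₀).2.2
      · rw [← div_le_iff₀ (zero_lt_one.trans_le (hp1 x))]
        exact hmax (subset_closure hx)
  have e1 : 1 < 2 / c := by rw [one_lt_div hq0]; exact hq2
  have e2 : 1 < 1 / β := by rw [one_lt_div hβ0]; exact hβ1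
  obtain ⟨l, hl1, hl2⟩ := exists_between (lt_min e1 e2)
  have hlc := hl2.trans_le (min_le_left _ _)
  have hlβ := hl2.trans_le (min_le_right _ _)
  rw [lt_div_iff₀ hq0] at hlc
  rw [lt_div_iff₀ hβ0] at hlβ
  refine ⟨l * c, l * β, lt_mul_of_one_lt_left hq0 hl1, hlc, by positivity, hlβ, fun x hx => ?_⟩
  have := hβ x hx
  nlinarith

lemma lintegral_lintegral_young_le {Ω : Set (RN N)} (hΩ : MeasurableSet Ω) {H : RN N → ℝ≥0∞}
    {k : RN N → RN N → ℝ≥0∞} (hHm : Measurable H)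
    (hkm : Measurable fun z : RN N × RN N => k z.1 z.2) (hksymm : ∀ x y, k x y = k y x)
    {I W : ℝ≥0∞} (hHI : ∫⁻ x in Ω, H x ≤ I) (hkW : ∀ x ∈ Ω, ∫⁻ y in Ω, k x y ≤ W) :
    ∫⁻ x in Ω, ∫⁻ y in Ω, (H x * k x y + H y * k x y + H x * H y) ≤ I * W + I * W + I * I := by
  have hm1 : Measurable fun z : RN N × RN N => H z.1 * k z.1 z.2 :=
    (hHm.comp measurable_fst).mul hkm
  have hm2 : Measurable fun z : RN N × RN N => H z.2 * k z.1 z.2 :=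
    (hHm.comp measurable_snd).mul hkm
  have hA : ∫⁻ x in Ω, ∫⁻ y in Ω, H x * k x y ≤ I * W := by
    calc ∫⁻ x in Ω, ∫⁻ y in Ω, H x * k x y = ∫⁻ x in Ω, H x * ∫⁻ y in Ω, k x y := by
          refine lintegral_congr fun x => ?_
          have i : Measurable fun y => k x y := hkm.comp measurable_prodMk_left
          rw [lintegral_const_mul _ i]
      _ ≤ ∫⁻ x in Ω, H x * W := by
          refine setLIntegral_mono' hΩ fun x hx => ?_
          gcongr
          exact hkW x hx
      _ = (∫⁻ x in Ω, H x) * W := lintegral_mul_const'' _ hHm.aemeasurable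
      _ ≤ I * W := by gcongr
  have hB : ∫⁻ x in Ω, ∫⁻ y in Ω, H y * k x y ≤ I * W := by
    rw [lintegral_lintegral_swap (hm2.aemeasurable)]
    refine le_trans (le_of_eq ?_) hA
    refine lintegral_congr fun x => lintegral_congr fun y => ?_
    rw [hksymm]
  have hD : ∫⁻ x in Ω, ∫⁻ y in Ω, H x * H y ≤ I * I := by
    calc ∫⁻ x in Ω, ∫⁻ y in Ω, H x * H y = ∫⁻ x in Ω, H x * ∫⁻ y in Ω, H y := by
          refine lintegral_congr fun x => ?_
          rw [lintegral_const_mul _ hHm]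
      _ = (∫⁻ x in Ω, H x) * ∫⁻ y in Ω, H y := lintegral_mul_const'' _ hHm.aemeasurable
      _ ≤ I * I := by gcongr
  calc ∫⁻ x in Ω, ∫⁻ y in Ω, (H x * k x y + H y * k x y + H x * H y)
      = (∫⁻ x in Ω, ∫⁻ y in Ω, H x * k x y) + (∫⁻ x in Ω, ∫⁻ y in Ω, H y * k x y) +
          ∫⁻ x in Ω, ∫⁻ y in Ω, H x * H y := by
        have j1 : Measurable fun x => ∫⁻ y in Ω, H x * k x y := hm1.lintegral_prod_right'
        have j2 : Measurable fun x => ∫⁻ y in Ω, H y * k x y := hm2.lintegral_prod_right'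
        have j12 : Measurable fun x => (∫⁻ y in Ω, H x * k x y) + ∫⁻ y in Ω, H y * k x y :=
          j1.add j2
        rw [← lintegral_add_left j1, ← lintegral_add_left j12]
        refine lintegral_congr fun x => ?_
        have i1 : Measurable fun y => H x * k x y := hm1.comp measurable_prodMk_left
        have i2 : Measurable fun y => H y * k x y := hm2.comp measurable_prodMk_left
        have i12 : Measurable fun y => H x * k x y + H y * k x y := i1.add i2
        rw [lintegral_add_left i12, lintegral_add_left i1]
    _ ≤ _ := add_le_add (add_le_add hA hB) hD

/-- Uniform bound of the Choquard-type double integral over the unit modular ball. -/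
lemma exists_choquard_bound (hN : 2 ≤ N) {Ω : Set (RN N)} (hΩo : IsOpen Ω)
    (hΩb : Bornology.IsBounded Ω) {s p μ q : RN N → RN N → ℝ} {r : RN N → ℝ} (hs : S1 s)
    (hp : P1 s p) (hμ : Mu1 μ) (hq : CPlus2 q)
    (hqμ : ∀ x y, 2 / q x y + μ x y / (N : ℝ) = 2) (hr : CPlusOn univ r) (hrM : MemM s p q r) :
    ∃ C : ℝ≥0∞, C ≠ ⊤ ∧ ∀ v, ModularBall Ω s p v →
      ∫⁻ x in Ω, ∫⁻ y in Ω, ENNReal.ofReal (|v x| ^ r x * |v y| ^ r y / dist x y ^ μ x y) ≤ C := by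
  have hN0 : (0 : ℝ) < N := by positivity
  obtain ⟨m, θ, hqm, hm2, hθ0, hθ1, hrm⟩ := exists_exponent hN hΩb hs hp hμ hq hqμ hr hrM
  have hq1 : 1 < sup2 q := (one_lt_of_cPlus2 hq 0 0).trans_le (le_sup2 hq.2.2 0 0)
  have hm1 : 1 < m := hq1.trans hqm
  set e := m / (2 * m - 2) with he
  have he0 : 0 < e := div_pos (by linarith) (by linarith)
  set ν := e * (N * (2 - 2 / sup2 q)) with hν
  have hνN : ν < N := by
    have h1 : m - 1 ≠ 0 := by linarith
    have h2 : sup2 q ≠ 0 := by linarith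
    have h3 : ν = N * (m * (sup2 q - 1) / ((m - 1) * sup2 q)) := by
      rw [hν, he]; field_simp
    rw [h3]
    refine mul_lt_of_lt_one_right hN0 ?_
    rw [div_lt_one (mul_pos (by linarith) (by linarith))]
    linarith
  obtain ⟨C₁, hC₁, hk⟩ := exists_lintegral_dist_rpow_le hN hΩb hνN
  obtain ⟨K, hK, hb⟩ := subcriticalBound_of_lt_one hN hΩo hΩb hs hp hθ0 hθ1
  have hΩt : volume Ω ≠ ⊤ := hΩb.measure_lt_top.ne
  set W := volume Ω + C₁ with hW
  set I := volume Ω + K with hI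
  have hWt : W ≠ ⊤ := ENNReal.add_ne_top.2 ⟨hΩt, hC₁⟩
  have hIt : I ≠ ⊤ := ENNReal.add_ne_top.2 ⟨hΩt, hK⟩
  refine ⟨I * W + I * W + I * I, ENNReal.add_ne_top.2 ⟨ENNReal.add_ne_top.2
    ⟨ENNReal.mul_ne_top hIt hWt, ENNReal.mul_ne_top hIt hWt⟩, ENNReal.mul_ne_top hIt hIt⟩,
    fun v hv => ?_⟩
  have hr1 : ∀ x, 1 < r x := fun x => hr.2.1.trans_le (infOn_univ_le (zero_lt_one.trans hr.2.1) x)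
  have hrc : Continuous r := continuousOn_univ.1 hr.1
  set H : RN N → ℝ≥0∞ := fun x => ENNReal.ofReal (|v x| ^ (r x * m)) with hH
  have hHm : Measurable H :=
    ((continuous_abs.measurable.comp hv.meas).pow (hrc.measurable.mul_const m)).ennreal_ofReal
  set k : RN N → RN N → ℝ≥0∞ := fun x y => 1 + ENNReal.ofReal (dist x y ^ (-ν)) with hkdef
  have hkm : Measurable fun z : RN N × RN N => k z.1 z.2 := by
    have : Measurable fun z : RN N × RN N => dist z.1 z.2 := by fun_prop
    exact (this.pow_const _).ennreal_ofReal.const_add 1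
  have hksymm : ∀ x y, k x y = k y x := fun x y => by simp only [hkdef, dist_comm]
  have hkW : ∀ x ∈ Ω, ∫⁻ y in Ω, k x y ≤ W := by
    intro x hx
    simp only [hkdef]
    rw [lintegral_add_left measurable_const, setLIntegral_const, one_mul]
    rw [hW]
    gcongr
    exact hk x hx
  have hHI : ∫⁻ x in Ω, H x ≤ I := by
    refine (setLIntegral_rpow_le_of_exponent_le hΩo (fun x _ => ?_) hrm).trans ?_
    · have := hr1 x
      positivity
    · rw [hI]; gcongr; exact hb v hv
  have hpt : ∀ x y, ENNReal.ofReal (|v x| ^ r x * |v y| ^ r y / dist x y ^ μ x y) ≤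
      H x * k x y + H y * k x y + H x * H y := by
    intro x y
    have hx0 := Real.rpow_nonneg (abs_nonneg (v x)) (r x)
    have hy0 := Real.rpow_nonneg (abs_nonneg (v y)) (r y)
    have hk0 : 0 ≤ (dist x y ^ μ x y)⁻¹ := inv_nonneg.2 (Real.rpow_nonneg dist_nonneg _)
    have hμ0 : 0 < μ x y := hμ.2.2.1.trans_le (inf2_le hμ.2.2.1 x y)
    have hμν : μ x y * e ≤ ν := by
      have h1 : μ x y ≤ N * (2 - 2 / sup2 q) := by
        rw [mu_eq hN hqμ]
        have := le_sup2 hq.2.2 x y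
        have := zero_lt_one.trans (one_lt_of_cPlus2 hq x y)
        gcongr
      rw [hν, mul_comm]
      gcongr
    have hke : ENNReal.ofReal ((dist x y ^ μ x y)⁻¹ ^ e) ≤ k x y := by
      rcases (dist_nonneg : 0 ≤ dist x y).eq_or_lt with h0 | h0
      · rw [← h0, Real.zero_rpow hμ0.ne', _root_.inv_zero, Real.zero_rpow he0.ne', ENNReal.ofReal_zero]
        exact zero_le
      · rw [← Real.rpow_neg h0.le, ← Real.rpow_mul h0.le, neg_mul]
        rcases le_total (dist x y) 1 with h1 | h1
        · refine le_trans (ENNReal.ofReal_le_ofReal ?_) le_add_self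
          exact Real.rpow_le_rpow_of_exponent_ge h0 h1 (by linarith)
        · refine le_trans ?_ le_self_add
          rw [ENNReal.ofReal_le_one]
          exact Real.rpow_le_one_of_one_le_of_nonpos h1 (by nlinarith)
    have hy := mul_mul_le_young hx0 hy0 hk0 hm1 hm2
    rw [← he, ← Real.rpow_mul (abs_nonneg _), ← Real.rpow_mul (abs_nonneg _)] at hy
    have hHx := Real.rpow_nonneg (abs_nonneg (v x)) (r x * m)
    have hHy := Real.rpow_nonneg (abs_nonneg (v y)) (r y * m)
    have hkr := Real.rpow_nonneg hk0 e
    rw [div_eq_mul_inv]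
    refine (ENNReal.ofReal_le_ofReal hy).trans ?_
    rw [ENNReal.ofReal_add (by positivity) (by positivity),
      ENNReal.ofReal_add (by positivity) (by positivity), ENNReal.ofReal_mul hHx,
      ENNReal.ofReal_mul hHy, ENNReal.ofReal_mul hHx]
    gcongr
  exact (lintegral_mono fun x => lintegral_mono fun y => hpt x y).trans
    (lintegral_lintegral_young_le hΩo.measurableSet hHm hkm hksymm hHI hkW)

lemma abs_Fant_le {Ω : Set (RN N)} {f : RN N → ℝ → ℝ} {M : ℝ} {r : RN N → ℝ}
    (hf1 : F1 Ω f M r) {x : RN N} (hx : x ∈ Ω) (hrx : 1 < r x) (t : ℝ) :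
    |Fant f x t| ≤ M * |t| ^ r x := by
  have hM := hf1.1
  have h : ∀ τ ∈ Set.uIoc 0 t, ‖f x τ‖ ≤ M * |t| ^ (r x - 1) := by
    intro τ hτ
    refine (hf1.2 x hx τ).trans ?_
    have h1 : |τ| ≤ |t| := by
      rcases le_total 0 t with h0 | h0
      · rw [Set.uIoc_of_le h0] at hτ
        rw [abs_of_pos hτ.1, abs_of_nonneg h0]; exact hτ.2
      · rw [Set.uIoc_of_ge h0] at hτ
        rw [abs_of_nonpos hτ.2, abs_of_nonpos h0]; linarith [hτ.1]
    have h2 : 0 ≤ r x - 1 := by linarith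
    gcongr
  have := intervalIntegral.norm_integral_le_of_norm_le_const h
  rw [sub_zero, Real.norm_eq_abs] at this
  refine this.trans (le_of_eq ?_)
  rcases eq_or_ne t 0 with h0 | h0
  · rw [h0, abs_zero, mul_zero, Real.zero_rpow (by linarith), mul_zero]
  · rw [mul_assoc, Real.rpow_sub_one (abs_ne_zero.2 h0), div_mul_cancel₀ _ (abs_ne_zero.2 h0)]

lemma modularBall_div {Ω : Set (RN N)} {s p : RN N → RN N → ℝ} {u : RN N → ℝ} {l : ℝ}
    (hu : Measurable u) (hz : ∀ᵐ x, x ∉ Ω → u x = 0) (hl : 0 < l)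
    (h : gmodular univ s p u l ≤ 1) : ModularBall Ω s p (fun x => u x / l) where
  meas := hu.div_const l
  zero := by filter_upwards [hz] with x hx h; rw [hx h, zero_div]
  le_one := by
    refine le_trans (le_of_eq ?_) h
    simp only [gmodular, div_one, ← sub_div, abs_div, abs_of_pos hl]

/-- The Choquard term is controlled by the modular. -/
lemma exists_choquard_le (hN : 2 ≤ N) {Ω : Set (RN N)} (hΩo : IsOpen Ω)
    (hΩb : Bornology.IsBounded Ω) {s p μ q : RN N → RN N → ℝ} {f : RN N → ℝ → ℝ} {M : ℝ}
    {r : RN N → ℝ} (hs : S1 s) (hp : P1 s p) (hμ : Mu1 μ) (hq : CPlus2 q)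
    (hqμ : ∀ x y, 2 / q x y + μ x y / (N : ℝ) = 2) (hr : CPlusOn univ r) (hrM : MemM s p q r)
    (hf1 : F1 Ω f M r) :
    ∃ C : ℝ, 0 ≤ C ∧ ∀ (u : RN N → ℝ) (l B : ℝ), Measurable u → (∀ᵐ x, x ∉ Ω → u x = 0) →
      0 < l → gmodular univ s p u l ≤ 1 → 0 ≤ B → (∀ x ∈ Ω, l ^ r x ≤ B) →
      ∫⁻ x in Ω, ∫⁻ y in Ω, ‖Fant f x (u x) * Fant f y (u y) / dist x y ^ μ x y‖ₑ ≤
        ENNReal.ofReal (B ^ 2 * C) := by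
  obtain ⟨C, hC, hb⟩ := exists_choquard_bound hN hΩo hΩb hs hp hμ hq hqμ hr hrM
  have hM := hf1.1
  refine ⟨M ^ 2 * C.toReal, by positivity, fun u l B hu hz hl hul hB hlB => ?_⟩
  have hv := hb _ (modularBall_div hu hz hl hul)
  have hr1 : ∀ x, 1 < r x := fun x => hr.2.1.trans_le (infOn_univ_le (zero_lt_one.trans hr.2.1) x)
  have hF : ∀ x ∈ Ω, |Fant f x (u x)| ≤ M * B * |u x / l| ^ r x := by
    intro x hx
    refine (abs_Fant_le hf1 hx (hr1 x) _).trans ?_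
    have h1 : |u x| ^ r x = l ^ r x * |u x / l| ^ r x := by
      rw [← Real.mul_rpow hl.le (abs_nonneg _), abs_div, abs_of_pos hl, mul_div_cancel₀ _ hl.ne']
    rw [h1, mul_assoc]
    have := hlB x hx
    gcongr
  calc ∫⁻ x in Ω, ∫⁻ y in Ω, ‖Fant f x (u x) * Fant f y (u y) / dist x y ^ μ x y‖ₑ
      ≤ ∫⁻ x in Ω, ∫⁻ y in Ω, ENNReal.ofReal ((M * B) ^ 2) *
          ENNReal.ofReal (|u x / l| ^ r x * |u y / l| ^ r y / dist x y ^ μ x y) := by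
        refine setLIntegral_mono' hΩo.measurableSet fun x hx => ?_
        refine setLIntegral_mono' hΩo.measurableSet fun y hy => ?_
        rw [← ENNReal.ofReal_mul (by positivity), Real.enorm_eq_ofReal_abs]
        refine ENNReal.ofReal_le_ofReal ?_
        have hd := Real.rpow_nonneg (dist_nonneg (x := x) (y := y)) (μ x y)
        rw [abs_div, abs_mul, abs_of_nonneg hd]
        calc |Fant f x (u x)| * |Fant f y (u y)| / dist x y ^ μ x y
            ≤ (M * B * |u x / l| ^ r x) * (M * B * |u y / l| ^ r y) / dist x y ^ μ x y := by
              have h1 := hF x hx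
              have h2 := hF y hy
              gcongr
          _ = _ := by ring
    _ = ENNReal.ofReal ((M * B) ^ 2) * ∫⁻ x in Ω, ∫⁻ y in Ω,
          ENNReal.ofReal (|u x / l| ^ r x * |u y / l| ^ r y / dist x y ^ μ x y) := by
        simp_rw [lintegral_const_mul' _ _ ENNReal.ofReal_ne_top]
    _ ≤ ENNReal.ofReal ((M * B) ^ 2) * C := by gcongr
    _ = _ := by
        rw [← ENNReal.ofReal_toReal hC, ← ENNReal.ofReal_mul (by positivity)]
        congr 1
        rw [ENNReal.toReal_ofReal ENNReal.toReal_nonneg]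
        ring

lemma abs_integral_integral_le {Ω : Set (RN N)} {g : RN N → RN N → ℝ} {K : ℝ} (hK : 0 ≤ K)
    (h : ∫⁻ x in Ω, ∫⁻ y in Ω, ‖g x y‖ₑ ≤ ENNReal.ofReal K) :
    |∫ x in Ω, ∫ y in Ω, g x y| ≤ K := by
  have h1 : ‖∫ x in Ω, ∫ y in Ω, g x y‖ₑ ≤ ENNReal.ofReal K :=
    (enorm_integral_le_lintegral_enorm _).trans
      ((lintegral_mono fun x => enorm_integral_le_lintegral_enorm _).trans h)
  rwa [Real.enorm_eq_ofReal_abs, ENNReal.ofReal_le_ofReal_iff hK] at h1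

lemma gmodular_le_mul {A : Set (RN N × RN N)} {s p : RN N → RN N → ℝ} {u : RN N → ℝ} {a b K : ℝ}
    (hp : P1 s p) (ha : 0 < a) (hb : 0 < b) (hK : ∀ x y, (b / a) ^ p x y ≤ K) :
    gmodular A s p u a ≤ ENNReal.ofReal K * gmodular A s p u b := by
  rw [gmodular, gmodular, ← lintegral_const_mul' _ _ ENNReal.ofReal_ne_top]
  refine lintegral_mono fun z => ?_
  have hp0 := (zero_lt_one.trans (hp.one_lt z.1 z.2)).le
  have h1 : |u z.1 - u z.2| / a = b / a * (|u z.1 - u z.2| / b) := by field_simp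
  rw [h1, ENNReal.ofReal_mul (by positivity), ENNReal.mul_rpow_of_nonneg _ _ hp0, mul_div_assoc,
    ENNReal.ofReal_rpow_of_nonneg (by positivity) hp0]
  gcongr
  exact hK _ _

lemma gmodular_anti {A : Set (RN N × RN N)} {s p : RN N → RN N → ℝ} {u : RN N → ℝ} {a b : ℝ}
    (hp : P1 s p) (ha : 0 < a) (hab : a ≤ b) : gmodular A s p u b ≤ gmodular A s p u a := by
  have hb := ha.trans_le hab
  have := gmodular_le_mul (A := A) (u := u) (K := 1) hp hb ha fun x y =>
    Real.rpow_le_one (by positivity) ((div_le_one hb).2 hab)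
      (zero_lt_one.trans (hp.one_lt x y)).le
  rwa [ENNReal.ofReal_one, one_mul] at this

lemma gmodular_const_mul {A : Set (RN N × RN N)} {s p : RN N → RN N → ℝ} {u : RN N → ℝ} {T l : ℝ}
    (hT : 0 < T) : gmodular A s p (fun x => T * u x) l = gmodular A s p u (l / T) := by
  refine lintegral_congr fun z => ?_
  rw [← mul_sub, abs_mul, abs_of_pos hT, div_div_eq_mul_div, mul_comm T]

lemma ofReal_rpow_div_eq_gker {s p : RN N → RN N → ℝ} {u : RN N → ℝ} (hp : P1 s p) (x y : RN N) :
    ENNReal.ofReal (|u x - u y| ^ p x y / dist x y ^ ((N : ℝ) + s x y * p x y)) =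
      gker s p u x y := by
  have hp0 := zero_lt_one.trans (hp.one_lt x y)
  rcases (dist_nonneg : 0 ≤ dist x y).eq_or_lt with h0 | h0
  · have hxy : x = y := dist_eq_zero.1 h0.symm
    subst hxy
    simp [gker, Real.zero_rpow hp0.ne', ENNReal.zero_rpow_of_pos hp0]
  · rw [gker, ENNReal.ofReal_div_of_pos (by positivity),
      ENNReal.ofReal_rpow_of_nonneg (abs_nonneg _) hp0.le, ENNReal.ofReal_rpow_of_pos h0]

/-- The kinetic part of the energy is comparable to the modular. -/
lemma kinetic_bounds {s p : RN N → RN N → ℝ} {u : RN N → ℝ} (hs : S1 s) (hp : P1 s p)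
    (hu : Measurable u) (hfin : gmodular univ s p u 1 ≠ ⊤) :
    (gmodular univ s p u 1).toReal / sup2 p ≤ (∫ z : RN N × RN N,
      |u z.1 - u z.2| ^ p z.1 z.2 /
        (p z.1 z.2 * dist z.1 z.2 ^ ((N : ℝ) + s z.1 z.2 * p z.1 z.2))) ∧
    (∫ z : RN N × RN N, |u z.1 - u z.2| ^ p z.1 z.2 /
        (p z.1 z.2 * dist z.1 z.2 ^ ((N : ℝ) + s z.1 z.2 * p z.1 z.2))) ≤
      (gmodular univ s p u 1).toReal := by
  set g : RN N × RN N → ℝ := fun z => |u z.1 - u z.2| ^ p z.1 z.2 /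
        (p z.1 z.2 * dist z.1 z.2 ^ ((N : ℝ) + s z.1 z.2 * p z.1 z.2)) with hg
  have hP := zero_lt_one.trans hp.one_lt_sup
  have hsm := hs.1.measurable
  have hpm := hp.1.1.measurable
  have h3 : Measurable fun z : RN N × RN N => |u z.1 - u z.2| := by fun_prop
  have h4 : Measurable fun z : RN N × RN N => dist z.1 z.2 := by fun_prop
  have hgm : Measurable g :=
    (h3.pow hpm).div (hpm.mul (h4.pow ((hsm.mul hpm).const_add (N : ℝ))))
  have hge : ∀ z, g z = (p z.1 z.2)⁻¹ * (|u z.1 - u z.2| ^ p z.1 z.2 /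
      dist z.1 z.2 ^ ((N : ℝ) + s z.1 z.2 * p z.1 z.2)) := by
    intro z
    simp only [hg]
    rw [mul_comm (p z.1 z.2), ← div_div, div_eq_inv_mul _ (p z.1 z.2)]
  have hp0 : ∀ z : RN N × RN N, 0 < p z.1 z.2 := fun z => zero_lt_one.trans (hp.one_lt _ _)
  have hgk : ∀ z, ENNReal.ofReal (g z) = ENNReal.ofReal (p z.1 z.2)⁻¹ * gker s p u z.1 z.2 := by
    intro z
    rw [hge, ENNReal.ofReal_mul (inv_nonneg.2 (hp0 z).le), ofReal_rpow_div_eq_gker hp]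
  have hg0 : ∀ z, 0 ≤ g z := by
    intro z
    have := hp0 z
    have := Real.rpow_nonneg (dist_nonneg (x := z.1) (y := z.2)) (N + s z.1 z.2 * p z.1 z.2)
    simp only [hg]
    positivity
  have hmod : gmodular univ s p u 1 = ∫⁻ z : RN N × RN N, gker s p u z.1 z.2 := by
    rw [gmodular, setLIntegral_univ]
    simp only [div_one, gker]
  have hle : ∫⁻ z, ENNReal.ofReal (g z) ≤ gmodular univ s p u 1 := by
    rw [hmod]
    refine lintegral_mono fun z => ?_
    rw [hgk]
    refine mul_le_of_le_one_left zero_le ?_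
    rw [ENNReal.ofReal_le_one]
    exact inv_le_one_of_one_le₀ (hp.one_lt _ _).le
  rw [integral_eq_lintegral_of_nonneg_ae (ae_of_all _ hg0) hgm.aestronglyMeasurable]
  refine ⟨?_, ENNReal.toReal_mono hfin hle⟩
  have hge' : ENNReal.ofReal (sup2 p)⁻¹ * gmodular univ s p u 1 ≤ ∫⁻ z, ENNReal.ofReal (g z) := by
    rw [hmod, ← lintegral_const_mul' _ _ ENNReal.ofReal_ne_top]
    refine lintegral_mono fun z => ?_
    rw [hgk]
    have := hp.le_sup z.1 z.2
    have := hp0 z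
    gcongr
  have := ENNReal.toReal_mono (hle.trans_lt hfin.lt_top).ne hge'
  rwa [ENNReal.toReal_mul, ENNReal.toReal_ofReal (by positivity), ← div_eq_inv_mul] at this

lemma gmodular_one_ne_top {Ω : Set (RN N)} (hΩo : IsOpen Ω) {s p : RN N → RN N → ℝ}
    {β : RN N → ℝ} {u : RN N → ℝ} (hp : P1 s p) (hu : MemX0 Ω s p β u) :
    gmodular univ s p u 1 ≠ ⊤ := by
  obtain ⟨-, -, ⟨l, hl, hfin⟩, hz⟩ := hu
  have hQ : MeasurableSet (Qset Ω) :=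
    MeasurableSet.univ.diff (hΩo.measurableSet.compl.prod hΩo.measurableSet.compl)
  have h1 : ∀ᵐ z : RN N × RN N, z.1 ∉ Ω → u z.1 = 0 := by
    rw [Measure.volume_eq_prod]
    exact Measure.quasiMeasurePreserving_fst.ae hz
  have h2 : ∀ᵐ z : RN N × RN N, z.2 ∉ Ω → u z.2 = 0 := by
    rw [Measure.volume_eq_prod]
    exact Measure.quasiMeasurePreserving_snd.ae hz
  have h3 : gmodular univ s p u l = gmodular (Qset Ω) s p u l := by
    rw [gmodular, gmodular, setLIntegral_univ, ← lintegral_indicator hQ]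
    refine lintegral_congr_ae ?_
    filter_upwards [h1, h2] with z hz1 hz2
    by_cases hzQ : z ∈ Qset Ω
    · rw [indicator_of_mem hzQ]
    · rw [indicator_of_notMem hzQ]
      have hz' : z.1 ∉ Ω ∧ z.2 ∉ Ω := by
        simpa [Qset, mem_prod] using hzQ
      have hp0 := zero_lt_one.trans (hp.one_lt z.1 z.2)
      rw [hz1 hz'.1, hz2 hz'.2, sub_zero, abs_zero, zero_div, ENNReal.ofReal_zero,
        ENNReal.zero_rpow_of_pos hp0, ENNReal.zero_div]
  refine (lt_of_le_of_lt (gmodular_le_mul (b := l) (K := max l 1 ^ sup2 p) hp zero_lt_one hl ?_)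
    (ENNReal.mul_lt_top ENNReal.ofReal_lt_top (h3 ▸ hfin))).ne
  intro x y
  have hp0 := zero_lt_one.trans (hp.one_lt x y)
  rw [div_one]
  exact (Real.rpow_le_rpow hl.le (le_max_left _ _) hp0.le).trans
    (Real.rpow_le_rpow_of_exponent_le (le_max_right _ _) (hp.le_sup x y))

lemma gmodular_le_one_of_x0Norm_lt {s p : RN N → RN N → ℝ} {u : RN N → ℝ} {l : ℝ} (hp : P1 s p)
    (h0 : 0 < x0Norm s p u) (hl : x0Norm s p u < l) : gmodular univ s p u l ≤ 1 := by
  have hne : {l | 0 < l ∧ gmodular univ s p u l < 1}.Nonempty := by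
    by_contra h
    rw [not_nonempty_iff_eq_empty] at h
    rw [x0Norm, h, Real.sInf_empty] at h0
    exact lt_irrefl _ h0
  obtain ⟨a, ⟨ha0, ha⟩, hal⟩ := exists_lt_of_csInf_lt hne hl
  exact (gmodular_anti hp ha0 hal.le).trans ha.le

lemma one_le_gmodular_of_lt_x0Norm {s p : RN N → RN N → ℝ} {u : RN N → ℝ} {l : ℝ}
    (h0 : 0 < l) (hl : l < x0Norm s p u) : 1 ≤ gmodular univ s p u l := by
  by_contra! h
  exact notMem_of_lt_csInf hl ⟨0, fun a ha => ha.1.le⟩ ⟨h0, h⟩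

lemma exists_mul_rpow_le {P R a : ℝ} (C : ℝ) (hC : 0 ≤ C) (hPR : P < R) (ha : 0 < a) :
    ∃ τ, 0 < τ ∧ τ ≤ 1 ∧ C * τ ^ R ≤ a * τ ^ P := by
  have hk : 0 < R - P := by linarith
  have hC1 : 0 < C + 1 := by linarith
  refine ⟨min 1 ((a / (C + 1)) ^ (1 / (R - P))), by positivity, min_le_left _ _, ?_⟩
  set τ := min 1 ((a / (C + 1)) ^ (1 / (R - P)))
  have hτ : 0 < τ := by positivity
  have h1 : τ ^ (R - P) ≤ a / (C + 1) := by
    calc τ ^ (R - P) ≤ ((a / (C + 1)) ^ (1 / (R - P))) ^ (R - P) := by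
          gcongr
          exact min_le_right _ _
      _ = a / (C + 1) := by
          rw [← Real.rpow_mul (by positivity), one_div_mul_cancel hk.ne', Real.rpow_one]
  have h2 : τ ^ R = τ ^ (R - P) * τ ^ P := by rw [← Real.rpow_add hτ, sub_add_cancel]
  rw [h2, ← mul_assoc]
  gcongr
  have h3 : 0 ≤ τ ^ (R - P) := by positivity
  rw [le_div_iff₀ hC1] at h1
  nlinarith

/-- Mountain-pass geometry near the origin. -/
lemma exists_lower_bound (hN : 2 ≤ N) {Ω : Set (RN N)} (hΩo : IsOpen Ω)
    (hΩb : Bornology.IsBounded Ω) {s p μ q : RN N → RN N → ℝ} {f : RN N → ℝ → ℝ} {M : ℝ}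
    {r : RN N → ℝ} (hs : S1 s) (hp : P1 s p) (hμ : Mu1 μ) (hq : CPlus2 q)
    (hqμ : ∀ x y, 2 / q x y + μ x y / (N : ℝ) = 2) (hr : CPlusOn univ r) (hrM : MemM s p q r)
    (hrp : sup2 p < infOn univ r) (hf1 : F1 Ω f M r) :
    ∃ δ ζ : ℝ, 0 < δ ∧ 0 < ζ ∧
      ∀ u : RN N → ℝ, MemX0 Ω s p (fun x => p x x) u → x0Norm s p u = δ →
        ζ ≤ Jfun Ω s p μ f u := by
  obtain ⟨C, hC, hb⟩ := exists_choquard_le hN hΩo hΩb hs hp hμ hq hqμ hr hrM hf1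
  have hP := hp.one_lt_sup
  have hR0 := zero_lt_one.trans hr.2.1
  have hP0 : 0 < sup2 p := by linarith
  have ha : 0 < (1 / 4 : ℝ) ^ sup2 p / sup2 p := by positivity
  set a := (1 / 4 : ℝ) ^ sup2 p / sup2 p with hadef
  obtain ⟨τ, hτ0, hτ1, hτ⟩ := exists_mul_rpow_le (P := sup2 p) (R := 2 * infOn univ r) C hC
    (by linarith) ha
  refine ⟨τ / 2, a / 2 * τ ^ sup2 p, by positivity, by positivity, fun u hu hnorm => ?_⟩
  have hle := gmodular_le_one_of_x0Norm_lt (l := τ) hp (by rw [hnorm]; positivity)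
    (by rw [hnorm]; linarith)
  have hge := one_le_gmodular_of_lt_x0Norm (l := τ / 4) (by positivity)
    (show τ / 4 < x0Norm s p u by rw [hnorm]; linarith)
  have hfin := gmodular_one_ne_top hΩo hp hu
  have hrho : (τ / 4) ^ sup2 p ≤ (gmodular univ s p u 1).toReal := by
    have h1 := hge.trans (gmodular_le_mul (b := 1) (K := (4 / τ) ^ sup2 p) hp (by positivity)
      zero_lt_one fun x y => by
        rw [one_div_div]
        refine Real.rpow_le_rpow_of_exponent_le ?_ (hp.le_sup x y)
        rw [le_div_iff₀ hτ0]
        linarith)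
    have h2 := ENNReal.toReal_mono (ENNReal.mul_ne_top ENNReal.ofReal_ne_top hfin) h1
    rw [ENNReal.toReal_mul, ENNReal.toReal_ofReal (by positivity), ENNReal.toReal_one] at h2
    have h3 : (τ / 4) ^ sup2 p = ((4 / τ) ^ sup2 p)⁻¹ := by
      rw [← Real.inv_rpow (by positivity), inv_div]
    rw [h3, inv_le_iff_one_le_mul₀' (by positivity)]
    exact h2
  have hkin := (kinetic_bounds hs hp hu.1 hfin).1
  have hcho := abs_integral_integral_le (by positivity)
    (hb u τ (τ ^ infOn univ r) hu.1 hu.2.2.2 hτ0 hle (by positivity) fun x _ =>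
      Real.rpow_le_rpow_of_exponent_ge hτ0 hτ1 (infOn_univ_le hR0 x))
  have hB : (τ ^ infOn univ r) ^ 2 = τ ^ (2 * infOn univ r) := by
    rw [mul_comm, Real.rpow_mul hτ0.le, Real.rpow_two]
  rw [hB, mul_comm] at hcho
  have h4 := (abs_le.1 hcho).2
  have h5 : a * τ ^ sup2 p ≤ (gmodular univ s p u 1).toReal / sup2 p := by
    have h6 : a * τ ^ sup2 p = (τ / 4) ^ sup2 p / sup2 p := by
      rw [hadef, show τ / 4 = 1 / 4 * τ by ring, Real.mul_rpow (by norm_num) hτ0.le]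
      ring
    rw [h6]
    gcongr
  rw [Jfun]
  linarith

/-- The hat function centred at `x₀` with radius `ρ`. -/
def hat (x₀ : RN N) (ρ : ℝ) (x : RN N) : ℝ := max 0 (1 - dist x x₀ / ρ)

lemma continuous_hat (x₀ : RN N) (ρ : ℝ) : Continuous (hat x₀ ρ) := by
  unfold hat; fun_prop

lemma hat_nonneg (x₀ : RN N) (ρ : ℝ) (x : RN N) : 0 ≤ hat x₀ ρ x := le_max_left _ _

lemma hat_le_one (x₀ : RN N) {ρ : ℝ} (hρ : 0 < ρ) (x : RN N) : hat x₀ ρ x ≤ 1 := by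
  have : 0 ≤ dist x x₀ / ρ := by positivity
  exact max_le zero_le_one (by linarith)

lemma hat_eq_zero {x₀ : RN N} {ρ : ℝ} (hρ : 0 < ρ) {x : RN N} (hx : x ∉ Metric.ball x₀ ρ) :
    hat x₀ ρ x = 0 := by
  rw [Metric.mem_ball, not_lt] at hx
  have : 1 ≤ dist x x₀ / ρ := by rwa [one_le_div hρ]
  exact max_eq_left (by linarith)

lemma half_le_hat {x₀ : RN N} {ρ : ℝ} (hρ : 0 < ρ) {x : RN N} (hx : x ∈ Metric.ball x₀ (ρ / 2)) :
    1 / 2 ≤ hat x₀ ρ x := by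
  rw [Metric.mem_ball] at hx
  have : dist x x₀ / ρ ≤ 1 / 2 := by rw [div_le_iff₀ hρ]; linarith
  exact (by linarith : 1 / 2 ≤ 1 - dist x x₀ / ρ).trans (le_max_right _ _)

lemma abs_hat_sub_le (x₀ : RN N) {ρ : ℝ} (hρ : 0 < ρ) (x y : RN N) :
    |hat x₀ ρ x - hat x₀ ρ y| ≤ dist x y / ρ := by
  have h := abs_max_sub_max_le_abs (1 - dist x x₀ / ρ) (1 - dist y x₀ / ρ) 0
  rw [max_comm _ (0 : ℝ), max_comm _ (0 : ℝ)] at h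
  refine h.trans ?_
  have h1 : 1 - dist x x₀ / ρ - (1 - dist y x₀ / ρ) = (dist y x₀ - dist x x₀) / ρ := by ring
  rw [h1, abs_div, abs_of_pos hρ, dist_comm x y]
  gcongr
  exact abs_dist_sub_le y x x₀

lemma abs_hat_sub_le_one (x₀ : RN N) {ρ : ℝ} (hρ : 0 < ρ) (x y : RN N) :
    |hat x₀ ρ x - hat x₀ ρ y| ≤ 1 := by
  have := hat_nonneg x₀ ρ x
  have := hat_nonneg x₀ ρ y
  have := hat_le_one x₀ hρ x
  have := hat_le_one x₀ hρ y
  rw [abs_le]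
  constructor <;> linarith

lemma lintegral_lintegral_mul_dist_add {χ : RN N → ℝ≥0∞} (hi : Measurable χ)
    {φ : ℝ → ℝ≥0∞} (hφ : Measurable φ) :
    ∫⁻ x, ∫⁻ y, (χ x * φ (dist x y) +
      χ y * φ (dist x y)) =
      (∫⁻ x, χ x) * (∫⁻ z : RN N, φ ‖z‖) + (∫⁻ x, χ x) * ∫⁻ z : RN N, φ ‖z‖ := by
  have hd : Measurable fun z : RN N × RN N => φ (dist z.1 z.2) :=
    hφ.comp (measurable_fst.dist measurable_snd)
  have hd' : ∀ x : RN N, Measurable fun y => φ (dist x y) := fun x =>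
    hφ.comp (measurable_const.dist measurable_id)
  have hm1 : Measurable fun z : RN N × RN N =>
      χ z.1 * φ (dist z.1 z.2) := (hi.comp measurable_fst).mul hd
  have hm2 : Measurable fun z : RN N × RN N =>
      χ z.2 * φ (dist z.1 z.2) := (hi.comp measurable_snd).mul hd
  have hA : ∫⁻ x, ∫⁻ y, χ x * φ (dist x y) =
      (∫⁻ x, χ x) * ∫⁻ z : RN N, φ ‖z‖ := by
    have h1 : ∀ x, ∫⁻ y, χ x * φ (dist x y) =
        χ x * ∫⁻ z : RN N, φ ‖z‖ := by
      intro x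
      rw [lintegral_const_mul _ (hd' x), lintegral_comp_dist]
    simp_rw [h1]
    exact lintegral_mul_const'' _ hi.aemeasurable
  have hC : ∫⁻ x, ∫⁻ y, χ y * φ (dist x y) =
      (∫⁻ x, χ x) * ∫⁻ z : RN N, φ ‖z‖ := by
    rw [lintegral_lintegral_swap hm2.aemeasurable, ← hA]
    simp_rw [dist_comm]
  rw [← hA]
  nth_rewrite 2 [hA]
  rw [← hC]
  have j1 : Measurable fun x => ∫⁻ y, χ x * φ (dist x y) :=
    hm1.lintegral_prod_right'
  rw [← lintegral_add_left j1]
  refine lintegral_congr fun x => ?_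
  have i1 : Measurable fun y => χ x * φ (dist x y) :=
    (hd' x).const_mul _
  rw [lintegral_add_left i1]

lemma gmodular_hat_ne_top (hN : 2 ≤ N) {s p : RN N → RN N → ℝ} (hs : S1 s) (hp : P1 s p)
    (x₀ : RN N) {ρ : ℝ} (hρ : 0 < ρ) : gmodular univ s p (hat x₀ ρ) 1 ≠ ⊤ := by
  have hs0 : 0 < inf2 s := hs.2.2.2.1
  have hs1 : sup2 s < 1 := hs.2.2.2.2
  have hP := hp.one_lt_sup
  set L := max 1 (1 / ρ) with hL
  have hL1 : 1 ≤ L := le_max_left _ _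
  set ν := (N : ℝ) - (1 - sup2 s) with hν
  set a := (N : ℝ) + inf2 s with ha
  have ha0 : 0 < a := by positivity
  set φ : ℝ → ℝ≥0∞ := fun d => ENNReal.ofReal (L ^ sup2 p) *
    (Iio (2 : ℝ)).indicator (fun d => ENNReal.ofReal (d ^ (-ν))) d +
    ENNReal.ofReal (2 ^ a) * ENNReal.ofReal ((1 + d) ^ (-a)) with hφ
  have hφm1 : Measurable fun d : ℝ => ENNReal.ofReal (L ^ sup2 p) *
      (Iio (2 : ℝ)).indicator (fun d => ENNReal.ofReal (d ^ (-ν))) d :=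
    ((measurable_id.pow_const (-ν)).ennreal_ofReal.indicator measurableSet_Iio).const_mul _
  have hφm : Measurable φ := hφm1.add (by fun_prop)
  have hfin : ∫⁻ z : RN N, φ ‖z‖ < ⊤ := by
    simp only [hφ]
    have hφn : Measurable fun z : RN N => ENNReal.ofReal (L ^ sup2 p) *
        (Iio (2 : ℝ)).indicator (fun d => ENNReal.ofReal (d ^ (-ν))) ‖z‖ :=
      hφm1.comp measurable_norm
    rw [lintegral_add_left hφn, lintegral_const_mul' _ _
      ENNReal.ofReal_ne_top, lintegral_const_mul' _ _ ENNReal.ofReal_ne_top]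
    refine ENNReal.add_lt_top.2 ⟨ENNReal.mul_lt_top ENNReal.ofReal_lt_top ?_,
      ENNReal.mul_lt_top ENNReal.ofReal_lt_top ?_⟩
    · refine lt_of_le_of_lt (le_of_eq ?_)
        (lintegral_norm_rpow_ball_lt_top hN (show ν < N by rw [hν]; linarith) 2)
      rw [← lintegral_indicator Metric.isOpen_ball.measurableSet]
      refine lintegral_congr fun z => ?_
      by_cases hz : ‖z‖ < 2
      · rw [indicator_of_mem (mem_Iio.2 hz), indicator_of_mem (mem_ball_zero_iff.2 hz)]
      · rw [indicator_of_notMem (mt mem_Iio.1 hz), indicator_of_notMem (mt mem_ball_zero_iff.1 hz)]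
    · exact (integrable_one_add_norm (by simp [ha, hs0])).lintegral_lt_top
  have hpt : ∀ x y, gker s p (hat x₀ ρ) x y ≤
      (Metric.ball x₀ ρ).indicator (1 : RN N → ℝ≥0∞) x * φ (dist x y) +
      (Metric.ball x₀ ρ).indicator (1 : RN N → ℝ≥0∞) y * φ (dist x y) := by
    intro x y
    have hp0 := zero_lt_one.trans (hp.one_lt x y)
    have hpl := hp.one_lt x y
    have hpP := hp.le_sup x y
    have hsS := hs.le_sup x y
    have hsI := hs.inf_le x y
    have hsp := hs.pos x y
    have hmain : gker s p (hat x₀ ρ) x y ≤ φ (dist x y) := by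
      rw [← ofReal_rpow_div_eq_gker hp]
      rcases (dist_nonneg : 0 ≤ dist x y).eq_or_lt with h0 | h0
      · have hxy : x = y := dist_eq_zero.1 h0.symm
        subst hxy
        simp [Real.zero_rpow hp0.ne']
      rcases le_total (dist x y) 1 with h1 | h1
      · refine le_trans ?_ le_self_add
        rw [indicator_of_mem (show dist x y ∈ Iio (2 : ℝ) by rw [mem_Iio]; linarith),
          ← ENNReal.ofReal_mul (by positivity)]
        refine ENNReal.ofReal_le_ofReal ?_
        calc |hat x₀ ρ x - hat x₀ ρ y| ^ p x y / dist x y ^ ((N : ℝ) + s x y * p x y)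
            ≤ (L * dist x y) ^ p x y / dist x y ^ ((N : ℝ) + s x y * p x y) := by
              have h2 : |hat x₀ ρ x - hat x₀ ρ y| ≤ L * dist x y := by
                refine (abs_hat_sub_le x₀ hρ x y).trans ?_
                rw [div_eq_mul_one_div, mul_comm]
                gcongr
                exact le_max_right _ _
              gcongr
          _ = L ^ p x y * dist x y ^ (p x y - ((N : ℝ) + s x y * p x y)) := by
              rw [Real.mul_rpow (by positivity) h0.le, Real.rpow_sub h0, mul_div_assoc]
          _ ≤ L ^ sup2 p * dist x y ^ (-ν) := by
              have h3 : dist x y ^ (p x y - ((N : ℝ) + s x y * p x y)) ≤ dist x y ^ (-ν) :=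
                Real.rpow_le_rpow_of_exponent_ge h0 h1 (by rw [hν]; nlinarith)
              gcongr
      · refine le_trans ?_ le_add_self
        rw [← ENNReal.ofReal_mul (by positivity)]
        refine ENNReal.ofReal_le_ofReal ?_
        calc |hat x₀ ρ x - hat x₀ ρ y| ^ p x y / dist x y ^ ((N : ℝ) + s x y * p x y)
            ≤ 1 / dist x y ^ a := by
              have h2 : |hat x₀ ρ x - hat x₀ ρ y| ^ p x y ≤ 1 :=
                Real.rpow_le_one (abs_nonneg _) (abs_hat_sub_le_one x₀ hρ x y) hp0.le
              have h3 : a ≤ (N : ℝ) + s x y * p x y := by rw [ha]; nlinarith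
              gcongr
          _ = 2 ^ a * (2 * dist x y) ^ (-a) := by
              rw [Real.mul_rpow zero_le_two h0.le, ← mul_assoc, ← Real.rpow_add zero_lt_two,
                add_neg_cancel, Real.rpow_zero, one_mul, Real.rpow_neg h0.le, one_div]
          _ ≤ 2 ^ a * (1 + dist x y) ^ (-a) := by
              refine mul_le_mul_of_nonneg_left ?_ (by positivity)
              exact Real.rpow_le_rpow_of_nonpos (by positivity) (by linarith) (by linarith)
    by_cases hx : x ∈ Metric.ball x₀ ρ
    · rw [indicator_of_mem hx, Pi.one_apply, one_mul]
      exact hmain.trans le_self_add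
    · by_cases hy : y ∈ Metric.ball x₀ ρ
      · rw [indicator_of_mem hy, Pi.one_apply, one_mul]
        exact hmain.trans le_add_self
      · rw [gker, hat_eq_zero hρ hx, hat_eq_zero hρ hy, sub_zero, abs_zero, ENNReal.ofReal_zero,
          ENNReal.zero_rpow_of_pos hp0, ENNReal.zero_div]
        exact zero_le
  rw [gmodular_one_eq hs hp (continuous_hat x₀ ρ).measurable]
  refine (lt_of_le_of_lt (lintegral_mono fun x => lintegral_mono fun y => hpt x y) ?_).ne
  rw [lintegral_lintegral_mul_dist_add
    (measurable_one.indicator Metric.isOpen_ball.measurableSet) hφm,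
    lintegral_indicator_one Metric.isOpen_ball.measurableSet]
  have hB : volume (Metric.ball x₀ ρ) < ⊤ := Metric.isBounded_ball.measure_lt_top
  exact ENNReal.add_lt_top.2 ⟨ENNReal.mul_lt_top hB hfin, ENNReal.mul_lt_top hB hfin⟩

lemma gmodular_hat_ne_zero (hN : 2 ≤ N) {s p : RN N → RN N → ℝ} (hs : S1 s) (hp : P1 s p)
    (x₀ : RN N) {ρ : ℝ} (hρ : 0 < ρ) : gmodular univ s p (hat x₀ ρ) 1 ≠ 0 := by
  intro h
  have hc := continuous_hat x₀ ρ
  have hmod : gmodular univ s p (hat x₀ ρ) 1 =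
      ∫⁻ z : RN N × RN N, gker s p (hat x₀ ρ) z.1 z.2 := by
    rw [gmodular, setLIntegral_univ]
    simp only [div_one, gker]
  rw [hmod, lintegral_eq_zero_iff (measurable_gker hs hp hc.measurable)] at h
  have h1 : (fun z : RN N × RN N => hat x₀ ρ z.1) =ᵐ[volume] fun z => hat x₀ ρ z.2 := by
    filter_upwards [h] with z hz
    have hp0 := zero_lt_one.trans (hp.one_lt z.1 z.2)
    have he : 0 < (N : ℝ) + s z.1 z.2 * p z.1 z.2 := by
      have := hs.pos z.1 z.2
      positivity
    rw [Pi.zero_apply, gker, ENNReal.div_eq_zero_iff] at hz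
    rcases hz with hz | hz
    · rw [ENNReal.rpow_eq_zero_iff_of_pos hp0, ENNReal.ofReal_eq_zero] at hz
      exact sub_eq_zero.1 (abs_nonpos_iff.1 hz)
    · exact absurd hz (ENNReal.rpow_ne_top_of_nonneg he.le ENNReal.ofReal_ne_top)
  have h2 := (Continuous.ae_eq_iff_eq volume (hc.comp continuous_fst) (hc.comp continuous_snd)).1 h1
  have : Nontrivial (RN N) := by
    have : Nonempty (Fin N) := ⟨⟨0, by omega⟩⟩
    infer_instance
  obtain ⟨y, hy⟩ := NormedSpace.exists_lt_norm ℝ (RN N) ρ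
  have h3 := congrFun h2 (x₀, x₀ + y)
  have h4 : x₀ + y ∉ Metric.ball x₀ ρ := by
    rw [Metric.mem_ball, dist_eq_norm, add_sub_cancel_left]
    exact not_lt.2 hy.le
  simp only [Function.comp_apply] at h3
  rw [hat_eq_zero hρ h4, hat, dist_self, zero_div, sub_zero] at h3
  norm_num at h3

lemma le_x0Norm_const_mul {s p : RN N → RN N → ℝ} {u : RN N → ℝ} {T : ℝ} (hp : P1 s p)
    (hT : 0 < T) (hfin : gmodular univ s p u 1 ≠ ⊤) :
    T * min 1 (gmodular univ s p u 1).toReal ≤ x0Norm s p (fun x => T * u x) := by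
  set c := (gmodular univ s p u 1).toReal with hc
  have hc0 : 0 ≤ c := ENNReal.toReal_nonneg
  have hcc : gmodular univ s p u 1 = ENNReal.ofReal c := (ENNReal.ofReal_toReal hfin).symm
  refine le_csInf ⟨T * (c + 1), by positivity, ?_⟩ ?_
  · rw [gmodular_const_mul hT, mul_div_cancel_left₀ _ hT.ne']
    refine (gmodular_le_mul (b := 1) (K := 1 / (c + 1)) hp (by positivity) zero_lt_one
      fun x y => ?_).trans_lt ?_
    · exact Real.rpow_le_self_of_le_one (by positivity)
        ((div_le_one (by positivity)).2 (by linarith)) (hp.one_lt x y).le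
    · rw [hcc, ← ENNReal.ofReal_mul (by positivity), ENNReal.ofReal_lt_one, one_div_mul_eq_div,
        div_lt_one (by positivity)]
      linarith
  · rintro l ⟨hl0, hl⟩
    rw [gmodular_const_mul hT] at hl
    rw [mul_comm, ← le_div_iff₀ hT]
    by_contra! h
    have hl1 : l / T < 1 := h.trans_le (min_le_left _ _)
    have hlc : l / T < c := h.trans_le (min_le_right _ _)
    have hl0' : 0 < l / T := by positivity
    have h1 := gmodular_le_mul (A := univ) (u := u) (a := 1) (b := l / T) (K := l / T) hp
      zero_lt_one hl0' fun x y => by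
        rw [div_one]
        exact Real.rpow_le_self_of_le_one hl0'.le hl1.le (hp.one_lt x y).le
    have h2 : gmodular univ s p u 1 ≤ ENNReal.ofReal (l / T) :=
      h1.trans (mul_le_of_le_one_right zero_le hl.le)
    rw [hcc, ENNReal.ofReal_le_ofReal_iff hl0'.le] at h2
    linarith

lemma memX0_const_mul_hat (hN : 2 ≤ N) {Ω : Set (RN N)} (hΩb : Bornology.IsBounded Ω)
    {s p : RN N → RN N → ℝ} (hs : S1 s) (hp : P1 s p) {x₀ : RN N} {ρ : ℝ} (hρ : 0 < ρ)
    (hsub : Metric.ball x₀ ρ ⊆ Ω) {T : ℝ} (hT : 0 < T) :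
    MemX0 Ω s p (fun x => p x x) (fun x => T * hat x₀ ρ x) := by
  have hm : Measurable fun x => T * hat x₀ ρ x := (continuous_hat x₀ ρ).measurable.const_mul T
  refine ⟨hm, ⟨hm, T, hT, ?_⟩, ⟨T, hT, ?_⟩, ae_of_all _ fun x hx => ?_⟩
  · refine lt_of_le_of_lt ?_ (hΩb.measure_lt_top (μ := volume))
    rw [lmodular, ← setLIntegral_one]
    refine lintegral_mono fun x => ?_
    have h0 := hat_nonneg x₀ ρ x
    rw [abs_of_nonneg (by positivity), mul_div_cancel_left₀ _ hT.ne']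
    refine ENNReal.rpow_le_one ?_ (zero_lt_one.trans (hp.one_lt x x)).le
    rw [ENNReal.ofReal_le_one]
    exact hat_le_one x₀ hρ x
  · rw [gmodular_const_mul hT, div_self hT.ne']
    refine lt_of_le_of_lt ?_ (gmodular_hat_ne_top hN hs hp x₀ hρ).lt_top
    exact lintegral_mono_set (subset_univ _)
  · simp only [hat_eq_zero hρ fun h => hx (hsub h), mul_zero]

lemma measurable_Fant_comp {f : RN N → ℝ → ℝ} (hf : Caratheodory f) {u : RN N → ℝ}
    (hu : Measurable u) : Measurable fun x => Fant f x (u x) := by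
  have hj : Measurable fun z : ℝ × RN N => f z.2 z.1 :=
    measurable_uncurry_of_continuous_of_measurable (u := fun t x => f x t) hf.2 hf.1
  have hF : ∀ t, Measurable fun x => Fant f x t := by
    intro t
    have h1 : ∀ A : Set ℝ, Measurable fun x => ∫ τ in A, f x τ := fun A =>
      ((hj.comp measurable_swap).stronglyMeasurable.integral_prod_right
        (f := fun x τ => f x τ) (ν := volume.restrict A)).measurable
    simp only [Fant, intervalIntegral]
    exact (h1 _).sub (h1 _)
  have hFc : ∀ x, Continuous fun t => Fant f x t := fun x =>
    intervalIntegral.continuous_primitive (fun a b => (hf.2 x).intervalIntegrable a b) 0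
  exact (measurable_uncurry_of_continuous_of_measurable (u := fun t x => Fant f x t) hFc hF).comp
    (hu.prodMk measurable_id)

lemma Fant_growth {f : RN N → ℝ → ℝ} (hf : Caratheodory f) {Θ : ℝ} {x : RN N}
    (h : ∀ t : ℝ, t ≠ 0 → 0 < Θ * Fant f x t ∧ Θ * Fant f x t ≤ 2 * (t * f x t)) {t : ℝ}
    (ht : 1 ≤ t) : Fant f x 1 * t ^ (Θ / 2) ≤ Fant f x t := by
  have hd : ∀ t, HasDerivAt (fun t => Fant f x t) (f x t) t := fun t =>
    intervalIntegral.integral_hasDerivAt_right ((hf.2 x).intervalIntegrable 0 t)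
      ((hf.2 x).stronglyMeasurableAtFilter _ _) (hf.2 x).continuousAt
  have hd2 : ∀ t : ℝ, 0 < t → HasDerivAt (fun t => Fant f x t * t ^ (-(Θ / 2)))
      (f x t * t ^ (-(Θ / 2)) + Fant f x t * (-(Θ / 2) * t ^ (-(Θ / 2) - 1))) t := fun t ht =>
    (hd t).mul (Real.hasDerivAt_rpow_const (Or.inl ht.ne'))
  have hmono : MonotoneOn (fun t => Fant f x t * t ^ (-(Θ / 2))) (Ici 1) := by
    refine monotoneOn_of_deriv_nonneg (convex_Ici 1) ?_ ?_ ?_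
    · exact fun t ht => (hd2 t (zero_lt_one.trans_le ht)).continuousAt.continuousWithinAt
    · rw [interior_Ici]
      exact fun t ht => (hd2 t (zero_lt_one.trans ht)).differentiableAt.differentiableWithinAt
    · rw [interior_Ici]
      intro t ht
      have ht0 : 0 < t := zero_lt_one.trans ht
      rw [(hd2 t ht0).deriv, Real.rpow_sub_one ht0.ne']
      have h1 := (h t ht0.ne').2
      have h2 : 0 ≤ t ^ (-(Θ / 2)) / t := by positivity
      have h3 : f x t * t ^ (-(Θ / 2)) + Fant f x t * (-(Θ / 2) * (t ^ (-(Θ / 2)) / t)) =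
          (t * f x t - Θ / 2 * Fant f x t) * (t ^ (-(Θ / 2)) / t) := by
        field_simp
        ring
      rw [h3]
      exact mul_nonneg (by linarith) h2
  have ht0 : 0 < t := zero_lt_one.trans_le ht
  have h1 := hmono self_mem_Ici (mem_Ici.2 ht) ht
  simp only [Real.one_rpow, mul_one] at h1
  rw [Real.rpow_neg ht0.le, ← div_eq_mul_inv, le_div_iff₀ (by positivity)] at h1
  exact h1

lemma measurable_choquard (hN : 2 ≤ N) {μ q : RN N → RN N → ℝ} {f : RN N → ℝ → ℝ}
    (hq : CPlus2 q) (hqμ : ∀ x y, 2 / q x y + μ x y / (N : ℝ) = 2) (hf : Caratheodory f)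
    {u : RN N → ℝ} (hu : Measurable u) :
    Measurable fun z : RN N × RN N =>
      Fant f z.1 (u z.1) * Fant f z.2 (u z.2) / dist z.1 z.2 ^ μ z.1 z.2 := by
  have hF := measurable_Fant_comp hf hu
  have hqm := hq.1.measurable
  have hμm : Measurable fun z : RN N × RN N => μ z.1 z.2 := by
    simp_rw [mu_eq hN hqμ]
    exact ((hqm.const_div 2).const_sub 2).const_mul _
  have h4 : Measurable fun z : RN N × RN N => dist z.1 z.2 := by fun_prop
  exact ((hF.comp measurable_fst).mul (hF.comp measurable_snd)).div (h4.pow hμm)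

lemma integral_integral_eq_toReal {A : Set (RN N)} {g : RN N → RN N → ℝ}
    (hg : Measurable fun z : RN N × RN N => g z.1 z.2)
    (h0 : ∀ᵐ x ∂volume.restrict A, ∀ᵐ y ∂volume.restrict A, 0 ≤ g x y)
    (hfin : ∫⁻ x in A, ∫⁻ y in A, ENNReal.ofReal (g x y) ≠ ⊤) :
    ∫ x in A, ∫ y in A, g x y = (∫⁻ x in A, ∫⁻ y in A, ENNReal.ofReal (g x y)).toReal := by
  have hG : Measurable fun x => ∫⁻ y in A, ENNReal.ofReal (g x y) :=
    hg.ennreal_ofReal.lintegral_prod_right'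
  rw [← integral_toReal hG.aemeasurable (ae_lt_top hG hfin)]
  refine integral_congr_ae ?_
  filter_upwards [h0] with x hx
  have i : Measurable fun y => g x y := hg.comp measurable_prodMk_left
  rw [integral_eq_lintegral_of_nonneg_ae hx i.aestronglyMeasurable]

lemma lintegral_lintegral_pos {A : Set (RN N)} (hA : volume A ≠ 0) {g : RN N → RN N → ℝ≥0∞}
    (hg : Measurable fun z : RN N × RN N => g z.1 z.2)
    (h0 : ∀ᵐ x ∂volume.restrict A, ∀ᵐ y ∂volume.restrict A, g x y ≠ 0) :
    ∫⁻ x in A, ∫⁻ y in A, g x y ≠ 0 := by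
  intro h
  have hne : NeBot (ae (volume.restrict A)) := by
    rw [ae_neBot]
    exact fun h' => hA (Measure.restrict_eq_zero.1 h')
  have hG : Measurable fun x => ∫⁻ y in A, g x y := hg.lintegral_prod_right'
  rw [lintegral_eq_zero_iff hG] at h
  obtain ⟨x, hx, hx0⟩ := (h.and h0).exists
  have i : Measurable fun y => g x y := hg.comp measurable_prodMk_left
  rw [Pi.zero_apply, lintegral_eq_zero_iff i] at hx
  obtain ⟨y, hy, hy0⟩ := (hx.and hx0).exists
  exact hy0 hy

/-- Superquadratic growth of the Choquard term along a ray. -/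
lemma exists_choquard_growth (hN : 2 ≤ N) {Ω : Set (RN N)} (hΩo : IsOpen Ω)
    (hΩb : Bornology.IsBounded Ω) {s p μ q : RN N → RN N → ℝ} {f : RN N → ℝ → ℝ} {M Θ : ℝ}
    {r : RN N → ℝ} (hs : S1 s) (hp : P1 s p) (hμ : Mu1 μ) (hq : CPlus2 q)
    (hqμ : ∀ x y, 2 / q x y + μ x y / (N : ℝ) = 2) (hf : Caratheodory f)
    (hr : CPlusOn univ r) (hrM : MemM s p q r) (hf1 : F1 Ω f M r) (hΘ : sup2 p < Θ)
    (hf2 : F2 Ω f Θ) {x₀ : RN N} {ρ : ℝ} (hρ : 0 < ρ) (hsub : Metric.ball x₀ ρ ⊆ Ω) :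
    ∃ c : ℝ, 0 < c ∧ ∀ T : ℝ, 2 ≤ T → c * (T / 2) ^ Θ ≤
      ∫ x in Ω, ∫ y in Ω, Fant f x (T * hat x₀ ρ x) * Fant f y (T * hat x₀ ρ y) /
        dist x y ^ μ x y := by
  obtain ⟨C, hC, hb⟩ := exists_choquard_le hN hΩo hΩb hs hp hμ hq hqμ hr hrM hf1
  have hP := hp.one_lt_sup
  have hΘ0 : 0 < Θ := by linarith
  have hfin := gmodular_hat_ne_top hN hs hp x₀ hρ
  have hpos : ∀ᵐ x, x ∈ Ω → ∀ t : ℝ, 0 ≤ Fant f x t ∧ (t ≠ 0 → 0 < Fant f x t) := by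
    filter_upwards [hf2] with x hx hxΩ t
    have h1 : t ≠ 0 → 0 < Fant f x t := fun ht => by
      have := (hx hxΩ t ht).1
      exact pos_of_mul_pos_right this hΘ0.le
    refine ⟨?_, h1⟩
    rcases eq_or_ne t 0 with rfl | ht
    · simp [Fant]
    · exact (h1 ht).le
  have hd0 : ∀ x y : RN N, 0 ≤ dist x y ^ μ x y := fun x y => Real.rpow_nonneg dist_nonneg _
  set g : ℝ → RN N → RN N → ℝ := fun T x y =>
    Fant f x (T * hat x₀ ρ x) * Fant f y (T * hat x₀ ρ y) / dist x y ^ μ x y with hg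
  have hgm : ∀ T, Measurable fun z : RN N × RN N => g T z.1 z.2 := fun T =>
    measurable_choquard hN hq hqμ hf ((continuous_hat x₀ ρ).measurable.const_mul T)
  have hgfin : ∀ T : ℝ, 0 < T → ∫⁻ x in Ω, ∫⁻ y in Ω, ENNReal.ofReal (g T x y) ≠ ⊤ := by
    intro T hT
    have hX := memX0_const_mul_hat hN hΩb hs hp hρ hsub hT
    set l := T * ((gmodular univ s p (hat x₀ ρ) 1).toReal + 1) with hl
    have hc0 : 0 ≤ (gmodular univ s p (hat x₀ ρ) 1).toReal := ENNReal.toReal_nonneg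
    have hl0 : 0 < l := by positivity
    have hle : gmodular univ s p (fun x => T * hat x₀ ρ x) l ≤ 1 := by
      rw [gmodular_const_mul hT, hl, mul_div_cancel_left₀ _ hT.ne']
      set c := (gmodular univ s p (hat x₀ ρ) 1).toReal with hc
      refine (gmodular_le_mul (b := 1) (K := 1 / (c + 1)) hp (by positivity) zero_lt_one
        fun x y => ?_).trans ?_
      · exact Real.rpow_le_self_of_le_one (by positivity)
          ((div_le_one (by positivity)).2 (by linarith)) (hp.one_lt x y).le
      · rw [← ENNReal.ofReal_toReal hfin, ← hc, ← ENNReal.ofReal_mul (by positivity),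
          ENNReal.ofReal_le_one, one_div_mul_eq_div, div_le_one (by positivity)]
        linarith
    have h1 := hb _ l (max 1 l ^ supOn univ r) hX.1 hX.2.2.2 hl0 hle (by positivity) fun x _ =>
      (Real.rpow_le_rpow hl0.le (le_max_right _ _) (by
        have := infOn_univ_le (zero_lt_one.trans hr.2.1) x
        linarith [hr.2.1])).trans
        (Real.rpow_le_rpow_of_exponent_le (le_max_left _ _)
          (le_csSup hr.2.2 ⟨x, mem_univ x, rfl⟩))
    refine (lt_of_le_of_lt ?_ (h1.trans_lt ENNReal.ofReal_lt_top)).ne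
    exact lintegral_mono fun x => lintegral_mono fun y => Real.ofReal_le_enorm _
  have hgint : ∀ T : ℝ, 0 < T → ∫ x in Ω, ∫ y in Ω, g T x y =
      (∫⁻ x in Ω, ∫⁻ y in Ω, ENNReal.ofReal (g T x y)).toReal := by
    intro T hT
    refine integral_integral_eq_toReal (hgm T) ?_ (hgfin T hT)
    have h1 : ∀ᵐ x ∂volume.restrict Ω, 0 ≤ Fant f x (T * hat x₀ ρ x) := by
      rw [ae_restrict_iff' hΩo.measurableSet]
      filter_upwards [hpos] with x hx hxΩ using (hx hxΩ _).1
    filter_upwards [h1] with x hx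
    filter_upwards [h1] with y hy
    exact div_nonneg (mul_nonneg hx hy) (hd0 x y)
  set B := Metric.ball x₀ (ρ / 2) with hB
  have hBm : MeasurableSet B := Metric.isOpen_ball.measurableSet
  have hBΩ : B ⊆ Ω := (Metric.ball_subset_ball (by linarith)).trans hsub
  set k : RN N → RN N → ℝ := fun x y => Fant f x 1 * Fant f y 1 / dist x y ^ μ x y with hk
  have hkm : Measurable fun z : RN N × RN N => k z.1 z.2 :=
    measurable_choquard hN hq hqμ hf measurable_const
  have hpos' : ∀ᵐ x ∂volume.restrict B, 0 < Fant f x 1 := by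
    rw [ae_restrict_iff' hBm]
    filter_upwards [hpos] with x hx hxB using (hx (hBΩ hxB) 1).2 one_ne_zero
  have hgrow : ∀ T : ℝ, 2 ≤ T → ∀ᵐ x ∂volume.restrict B,
      Fant f x 1 * (T / 2) ^ (Θ / 2) ≤ Fant f x (T * hat x₀ ρ x) := by
    intro T hT
    have h2 : ∀ᵐ x ∂volume.restrict B, x ∈ B := ae_restrict_mem hBm
    have h3 : ∀ᵐ x ∂volume.restrict B, x ∈ Ω → ∀ t : ℝ, t ≠ 0 →
      0 < Θ * Fant f x t ∧ Θ * Fant f x t ≤ 2 * (t * f x t) := ae_restrict_of_ae hf2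
    filter_upwards [hpos', h2, h3] with x hx hxB hx2
    have h4 := half_le_hat hρ hxB
    have h5 : T / 2 ≤ T * hat x₀ ρ x := by nlinarith
    refine le_trans ?_ (Fant_growth hf (hx2 (hBΩ hxB)) (by linarith))
    gcongr
  have hlow : ∀ T : ℝ, 2 ≤ T → ENNReal.ofReal ((T / 2) ^ Θ) *
      ∫⁻ x in B, ∫⁻ y in B, ENNReal.ofReal (k x y) ≤
        ∫⁻ x in Ω, ∫⁻ y in Ω, ENNReal.ofReal (g T x y) := by
    intro T hT
    calc ENNReal.ofReal ((T / 2) ^ Θ) * ∫⁻ x in B, ∫⁻ y in B, ENNReal.ofReal (k x y)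
        = ∫⁻ x in B, ∫⁻ y in B, ENNReal.ofReal ((T / 2) ^ Θ) * ENNReal.ofReal (k x y) := by
          simp_rw [lintegral_const_mul' _ _ ENNReal.ofReal_ne_top]
      _ ≤ ∫⁻ x in B, ∫⁻ y in B, ENNReal.ofReal (g T x y) := by
          refine lintegral_mono_ae ?_
          filter_upwards [hgrow T hT, hpos'] with x hx hx0
          refine lintegral_mono_ae ?_
          filter_upwards [hgrow T hT, hpos'] with y hy hy0
          have hT0 : 0 ≤ T / 2 := by linarith
          rw [← ENNReal.ofReal_mul (by positivity)]
          refine ENNReal.ofReal_le_ofReal ?_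
          have h6 : (T / 2) ^ Θ = (T / 2) ^ (Θ / 2) * (T / 2) ^ (Θ / 2) := by
            rw [← Real.rpow_add (by linarith), add_halves]
          have hd := hd0 x y
          calc (T / 2) ^ Θ * k x y = (Fant f x 1 * (T / 2) ^ (Θ / 2)) *
                (Fant f y 1 * (T / 2) ^ (Θ / 2)) / dist x y ^ μ x y := by
                simp only [hk]
                rw [h6]
                ring
            _ ≤ g T x y := by
                simp only [hg]
                have hx1 : 0 ≤ Fant f x 1 * (T / 2) ^ (Θ / 2) := by positivity
                have hx2 := hx1.trans hx
                gcongr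
      _ ≤ ∫⁻ x in Ω, ∫⁻ y in Ω, ENNReal.ofReal (g T x y) :=
          (lintegral_mono_set hBΩ).trans
            (lintegral_mono fun x => lintegral_mono_set hBΩ)
  have hkfin : ∫⁻ x in B, ∫⁻ y in B, ENNReal.ofReal (k x y) ≠ ⊤ := by
    have h1 := hlow 2 le_rfl
    rw [div_self two_ne_zero, Real.one_rpow, ENNReal.ofReal_one, one_mul] at h1
    exact (h1.trans_lt (hgfin 2 two_pos).lt_top).ne
  have hkpos : ∫⁻ x in B, ∫⁻ y in B, ENNReal.ofReal (k x y) ≠ 0 := by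
    have : Nontrivial (RN N) := by
      have : Nonempty (Fin N) := ⟨⟨0, by omega⟩⟩
      infer_instance
    refine lintegral_lintegral_pos (Metric.measure_ball_pos _ _ (by positivity)).ne'
      hkm.ennreal_ofReal ?_
    filter_upwards [hpos'] with x hx
    have hne : ∀ᵐ y ∂volume.restrict B, y ≠ x :=
      ae_restrict_of_ae (compl_mem_ae_iff.2 (measure_singleton x))
    filter_upwards [hpos', hne] with y hy hyx
    have hd : 0 < dist x y := dist_pos.2 hyx.symm
    have : 0 < k x y := by
      simp only [hk]
      positivity
    exact (ENNReal.ofReal_pos.2 this).ne'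
  refine ⟨(∫⁻ x in B, ∫⁻ y in B, ENNReal.ofReal (k x y)).toReal,
    ENNReal.toReal_pos hkpos hkfin, fun T hT => ?_⟩
  have hT0 : 0 < T := by linarith
  have h1 := ENNReal.toReal_mono (hgfin T hT0) (hlow T hT)
  rw [ENNReal.toReal_mul, ENNReal.toReal_ofReal (by positivity), ← hgint T hT0] at h1
  rwa [mul_comm]

/-- Mountain-pass geometry far from the origin. -/
lemma exists_negative_energy (hN : 2 ≤ N) {Ω : Set (RN N)} (hΩo : IsOpen Ω)
    (hΩb : Bornology.IsBounded Ω) (hΩne : Ω.Nonempty) {s p μ q : RN N → RN N → ℝ}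
    {f : RN N → ℝ → ℝ} {M Θ : ℝ} {r : RN N → ℝ} (hs : S1 s) (hp : P1 s p) (hμ : Mu1 μ)
    (hq : CPlus2 q) (hqμ : ∀ x y, 2 / q x y + μ x y / (N : ℝ) = 2) (hf : Caratheodory f)
    (hr : CPlusOn univ r) (hrM : MemM s p q r) (hf1 : F1 Ω f M r) (hΘ : sup2 p < Θ)
    (hf2 : F2 Ω f Θ) (δ : ℝ) :
    ∃ φ : RN N → ℝ, MemX0 Ω s p (fun x => p x x) φ ∧ δ < x0Norm s p φ ∧
      Jfun Ω s p μ f φ < 0 := by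
  obtain ⟨x₀, hx₀⟩ := hΩne
  obtain ⟨ρ, hρ, hsub⟩ := Metric.isOpen_iff.1 hΩo x₀ hx₀
  obtain ⟨c, hc, hgrow⟩ := exists_choquard_growth hN hΩo hΩb hs hp hμ hq hqμ hf hr hrM hf1 hΘ hf2
    hρ hsub
  have hfin := gmodular_hat_ne_top hN hs hp x₀ hρ
  set κ := (gmodular univ s p (hat x₀ ρ) 1).toReal with hκ
  have hκ0 : 0 < κ := ENNReal.toReal_pos (gmodular_hat_ne_zero hN hs hp x₀ hρ) hfin
  have hm0 : 0 < min 1 κ := lt_min zero_lt_one hκ0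
  have hlim : Tendsto (fun T : ℝ => T ^ (Θ - sup2 p)) atTop atTop :=
    tendsto_rpow_atTop (by linarith)
  obtain ⟨T, hT2, hTδ, hTJ⟩ := ((eventually_ge_atTop (2 : ℝ)).and
    ((eventually_gt_atTop (δ / min 1 κ)).and
      (hlim.eventually_gt_atTop (2 * κ * 2 ^ Θ / c)))).exists
  have hT0 : 0 < T := by linarith
  have hX := memX0_const_mul_hat hN hΩb hs hp hρ hsub hT0
  refine ⟨fun x => T * hat x₀ ρ x, hX, ?_, ?_⟩
  · rw [div_lt_iff₀ hm0] at hTδ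
    exact hTδ.trans_le (le_x0Norm_const_mul hp hT0 hfin)
  · have hkin := (kinetic_bounds hs hp hX.1 (gmodular_one_ne_top hΩo hp hX)).2
    have hmod : (gmodular univ s p (fun x => T * hat x₀ ρ x) 1).toReal ≤ T ^ sup2 p * κ := by
      rw [gmodular_const_mul hT0, hκ]
      have h1 := gmodular_le_mul (A := univ) (u := hat x₀ ρ) (a := 1 / T) (b := 1)
        (K := T ^ sup2 p) hp (by positivity) zero_lt_one fun x y => by
          rw [one_div_one_div]
          exact Real.rpow_le_rpow_of_exponent_le (by linarith) (hp.le_sup x y)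
      have h2 := ENNReal.toReal_mono (ENNReal.mul_ne_top ENNReal.ofReal_ne_top hfin) h1
      rwa [ENNReal.toReal_mul, ENNReal.toReal_ofReal (by positivity)] at h2
    have hch := hgrow T hT2
    have hP0 : 0 < T ^ sup2 p := by positivity
    have h20 : (0 : ℝ) < 2 ^ Θ := by positivity
    have hfinal : T ^ sup2 p * κ < 1 / 2 * (c * (T / 2) ^ Θ) := by
      have h3 : (T / 2) ^ Θ = T ^ sup2 p * T ^ (Θ - sup2 p) / 2 ^ Θ := by
        rw [Real.div_rpow hT0.le zero_le_two, ← Real.rpow_add hT0, add_sub_cancel]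
      rw [div_lt_iff₀ hc] at hTJ
      rw [h3, show 1 / 2 * (c * (T ^ sup2 p * T ^ (Θ - sup2 p) / 2 ^ Θ)) =
        T ^ sup2 p * (T ^ (Θ - sup2 p) * c / (2 * 2 ^ Θ)) by field_simp]
      gcongr
      rw [lt_div_iff₀ (by positivity)]
      linarith
    rw [Jfun]
    linarith

theorem statement12
    {N : ℕ} (hN : 2 ≤ N) (Ω : Set (RN N))
    (hΩo : IsOpen Ω) (hΩb : Bornology.IsBounded Ω) (hΩne : Ω.Nonempty)
    (s p μ q : RN N → RN N → ℝ) (f : RN N → ℝ → ℝ) (M Θ : ℝ) (r : RN N → ℝ)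
    (hs : S1 s) (hp : P1 s p) (hμ : Mu1 μ) (hq : CPlus2 q)
    (hqμ : ∀ x y, 2 / q x y + μ x y / (N : ℝ) = 2)
    (hf : Caratheodory f)
    (hr : CPlusOn univ r) (hrM : MemM s p q r) (hrp : sup2 p < infOn univ r)
    (hf1 : F1 Ω f M r) (hΘ : sup2 p < Θ) (hf2 : F2 Ω f Θ)
    :
    ∃ δ ζ : ℝ, 0 < δ ∧ 0 < ζ ∧
      (∀ u : RN N → ℝ, MemX0 Ω s p (fun x => p x x) u → x0Norm s p u = δ →
        ζ ≤ Jfun Ω s p μ f u) ∧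
      ∃ φ : RN N → ℝ, MemX0 Ω s p (fun x => p x x) φ ∧ δ < x0Norm s p φ ∧
        Jfun Ω s p μ f φ < 0 := by
  obtain ⟨δ, ζ, hδ, hζ, h⟩ :=
    exists_lower_bound hN hΩo hΩb hs hp hμ hq hqμ hr hrM hrp hf1
  exact ⟨δ, ζ, hδ, hζ, h,
    exists_negative_energy hN hΩo hΩb hΩne hs hp hμ hq hqμ hf hr hrM hf1 hΘ hf2 δ⟩

end VarOrderChoquard
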